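/- arXiv:2603.08121 — 6 statements merged into one kernel-verified Lean document; each statement's English description precedes it below -/
import Mathlib

section
/- Let d ≥ 3 be odd, ℓ a positive integer and ε > 0. There exists a constant C = C(ε,ℓ,d) > 0 such that every pure field K of degree d satisfies #Cl_K[ℓ] ≤ C · D_K^{1/2 − 1/(2(d−1)ℓ) + ε}. -/
open NumberField Polynomial

/-- The denominator ideal of `α ∈ K`: the set of `x ∈ 𝓞 K` with `x·α ∈ 𝓞 K`.
Its absolute norm is the non-archimedean part `∏_v max(1,|α|_v)^{d_v}` of the height. -/
noncomputable def denIdeal (K : Type*) [Field K] [NumberField K] (α : K) : Ideal (𝓞 K) where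
  carrier := {x : 𝓞 K | ∃ y : 𝓞 K, (x : K) * α = (y : K)}
  zero_mem' := ⟨0, by simp⟩
  add_mem' := by
    rintro a b ⟨ya, ha⟩ ⟨yb, hb⟩
    exact ⟨ya + yb, by push_cast; rw [add_mul, ha, hb]⟩
  smul_mem' := by
    rintro c x ⟨y, hy⟩
    exact ⟨c * y, by rw [smul_eq_mul]; push_cast; rw [mul_assoc, hy]⟩

/-- The relative multiplicative Weil height `H_K(α) = ∏_{v ∈ M_K} max(1,|α|_v)^{d_v}`. -/
noncomputable def heightK (K : Type*) [Field K] [NumberField K] (α : K) : ℝ :=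
  (Ideal.absNorm (denIdeal K α) : ℝ) * ∏ w : InfinitePlace K, max 1 (w α) ^ w.mult

/-- `N'_K(X)`: the number of `α ∈ K` with `ℚ(α) = K` and `H_K(α) < X`. -/
noncomputable def NprimeK (K : Type*) [Field K] [NumberField K] (X : ℝ) : ℕ :=
  Nat.card {α : K // IntermediateField.adjoin ℚ {α} = ⊤ ∧ heightK K α < X}

/-- `M_{K,ℓ} = inf_{X > 0} X^{-1/ℓ}(1 + N'_K(X))`. -/
noncomputable def MKl (K : Type*) [Field K] [NumberField K] (ℓ : ℕ) : ℝ :=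
  ⨅ X : {X : ℝ // 0 < X}, (X : ℝ) ^ (-(1:ℝ)/ℓ) * (1 + (NprimeK K X : ℝ))

/-- `η(K)`: the minimal height of a primitive element of `K`. -/
noncomputable def etaK (K : Type*) [Field K] [NumberField K] : ℝ :=
  sInf {x : ℝ | ∃ α : K, IntermediateField.adjoin ℚ {α} = ⊤ ∧ heightK K α = x}

/-- `D_K`: the absolute value of the discriminant. -/
noncomputable def DK (K : Type*) [Field K] [NumberField K] : ℕ :=
  (NumberField.discr K).natAbs

lemma dvd_absNorm_of_natCast_mem {K : Type*} [Field K] [NumberField K] {P : Ideal (𝓞 K)} {p : ℕ}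
    (hp : p.Prime) (hP : P.IsPrime) (hpP : (p : 𝓞 K) ∈ P) : p ∣ Ideal.absNorm P := by
  have hdvd : Ideal.absNorm P ∣ p ^ Module.finrank ℚ K := by
    have := Ideal.absNorm_dvd_absNorm_of_le ((Ideal.span_singleton_le_iff_mem P).mpr hpP)
    rwa [Ideal.absNorm_span_natCast, RingOfIntegers.rank] at this
  obtain ⟨k, -, hk⟩ := (Nat.dvd_prime_pow hp).mp hdvd
  rcases Nat.eq_zero_or_pos k with rfl | hk0
  · rw [pow_zero, Ideal.absNorm_eq_one_iff] at hk
    exact absurd hk hP.ne_top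
  · rw [hk]; exact dvd_pow_self p hk0.ne'

lemma card_primes_mem_le {K : Type*} [Field K] [NumberField K] {p : ℕ} (hp : p.Prime)
    (S : Finset (Ideal (𝓞 K))) (hS : ∀ P ∈ S, P.IsPrime ∧ P ≠ ⊥ ∧ (p : 𝓞 K) ∈ P) :
    S.card ≤ Module.finrank ℚ K := by
  have hdvd : ∏ P ∈ S, P ∣ Ideal.span {(p : 𝓞 K)} := by
    refine Finset.prod_primes_dvd _ (fun P hP => ?_) (fun P hP => ?_)
    · exact (Ideal.prime_iff_isPrime (hS P hP).2.1).mpr (hS P hP).1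
    · rw [Ideal.dvd_span_singleton]; exact (hS P hP).2.2
  have h1 : Ideal.absNorm (∏ P ∈ S, P) ∣ p ^ Module.finrank ℚ K := by
    have := Ideal.absNorm_dvd_absNorm_of_le (Ideal.dvd_iff_le.mp hdvd)
    rwa [Ideal.absNorm_span_natCast, RingOfIntegers.rank] at this
  rw [map_prod] at h1
  have h2 : ∀ P ∈ S, p ∣ Ideal.absNorm P := fun P hP => by
    exact dvd_absNorm_of_natCast_mem hp (hS P hP).1 (hS P hP).2.2
  have h3 : p ^ S.card ∣ ∏ P ∈ S, Ideal.absNorm P := by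
    rw [← Finset.prod_const]
    exact Finset.prod_dvd_prod_of_dvd _ _ h2
  exact (Nat.pow_dvd_pow_iff_le_right hp.one_lt).mp (h3.trans h1)

/-- A labelling of the prime ideals by `d = [K : ℚ]` labels which separates the primes above
each rational prime. -/
lemma exists_label (K : Type*) [Field K] [NumberField K] :
    ∃ lab : Ideal (𝓞 K) → Fin (Module.finrank ℚ K), ∀ (p : ℕ) (P Q : Ideal (𝓞 K)), p.Prime →
      P.IsPrime → P ≠ ⊥ → Q.IsPrime → Q ≠ ⊥ → p ∣ Ideal.absNorm P → p ∣ Ideal.absNorm Q →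
      lab P = lab Q → P = Q := by
  classical
  have hfin : ∀ p : ℕ, p.Prime → {P : Ideal (𝓞 K) | P.IsPrime ∧ P ≠ ⊥ ∧ (p : 𝓞 K) ∈ P}.Finite := by
    intro p hp
    by_contra h
    obtain ⟨S, hS, hc⟩ := Set.Infinite.exists_subset_card_eq h (Module.finrank ℚ K + 1)
    have := card_primes_mem_le hp S (fun P hP => hS hP)
    omega
  have hpos : 0 < Module.finrank ℚ K := Module.finrank_pos
  have hemb : ∀ p : ℕ, ∃ f : Ideal (𝓞 K) → Fin (Module.finrank ℚ K), p.Prime →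
      Set.InjOn f {P : Ideal (𝓞 K) | P.IsPrime ∧ P ≠ ⊥ ∧ (p : 𝓞 K) ∈ P} := by
    intro p
    by_cases hp : p.Prime
    swap
    · exact ⟨fun _ => ⟨0, hpos⟩, fun h => absurd h hp⟩
    have hcard : (hfin p hp).toFinset.card ≤ Module.finrank ℚ K :=
      card_primes_mem_le hp _ (fun P hP => by simpa using hP)
    let e := (hfin p hp).toFinset.equivFin
    refine ⟨fun P => if h : P ∈ (hfin p hp).toFinset then Fin.castLE hcard (e ⟨P, h⟩)
      else ⟨0, hpos⟩, fun _ P hP Q hQ hPQ => ?_⟩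
    have hP' : P ∈ (hfin p hp).toFinset := by simpa using hP
    have hQ' : Q ∈ (hfin p hp).toFinset := by simpa using hQ
    simp only [dif_pos hP', dif_pos hQ'] at hPQ
    have := e.injective (Fin.castLE_injective hcard hPQ)
    simpa using this
  choose f hf using hemb
  have hmin : ∀ (p : ℕ) (P : Ideal (𝓞 K)), p.Prime → P.IsPrime → P ≠ ⊥ → p ∣ Ideal.absNorm P →
      (p : 𝓞 K) ∈ P ∧ (Ideal.absNorm P).minFac = p := by
    intro p P hp hP hP0 hd
    have := hP.isMaximal hP0
    obtain ⟨r, k, hk, hmem, hr, hrk⟩ := Ideal.exists_prime_and_absNorm_eq_pow P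
    have hpr : p = r := by
      rw [hrk] at hd
      exact (Nat.prime_dvd_prime_iff_eq hp hr).mp (hp.dvd_of_dvd_pow hd)
    subst hpr
    exact ⟨hmem, by rw [hrk, hp.pow_minFac hk.ne']⟩
  refine ⟨fun P => f (Ideal.absNorm P).minFac P, ?_⟩
  intro p P Q hp hP hP0 hQ hQ0 hdP hdQ h
  obtain ⟨hP1, hP2⟩ := hmin p P hp hP hP0 hdP
  obtain ⟨hQ1, hQ2⟩ := hmin p Q hp hQ hQ0 hdQ
  simp only [hP2, hQ2] at h
  exact hf p hp ⟨hP, hP0, hP1⟩ ⟨hQ, hQ0, hQ1⟩ h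

open UniqueFactorizationMonoid in
/-- Nonzero ideals are parametrised injectively by `d`-tuples of positive integers whose
product is the norm. -/
lemma exists_ideal_encoding (K : Type*) [Field K] [NumberField K] :
    ∃ Φ : Ideal (𝓞 K) → Fin (Module.finrank ℚ K) → ℕ,
      (∀ I, I ≠ ⊥ → ∏ i, Φ I i = Ideal.absNorm I) ∧ Set.InjOn Φ {I | I ≠ ⊥} := by
  classical
  obtain ⟨lab, hlab⟩ := exists_label K
  refine ⟨fun I i => (((normalizedFactors I).filter (lab · = i)).map Ideal.absNorm).prod, ?_, ?_⟩
  · intro I hI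
    change ∏ i, (((normalizedFactors I).filter (lab · = i)).map Ideal.absNorm).prod = _
    conv_rhs => rw [← Ideal.prod_normalizedFactors_eq_self hI, map_multiset_prod]
    generalize normalizedFactors I = s
    induction s using Multiset.induction_on with
    | empty => simp
    | cons P s ih =>
      rw [Multiset.map_cons, Multiset.prod_cons, ← ih]
      have : ∀ i, (((P ::ₘ s).filter (lab · = i)).map Ideal.absNorm).prod =
          (if lab P = i then Ideal.absNorm P else 1) *
          ((s.filter (lab · = i)).map Ideal.absNorm).prod := by
        intro i
        by_cases h : lab P = i <;> simp [h]
      rw [Finset.prod_congr rfl (fun i _ => this i), Finset.prod_mul_distrib]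
      simp
  · intro I hI J hJ hIJ
    have hprime : ∀ {I P : Ideal (𝓞 K)}, P ∈ normalizedFactors I → P.IsPrime ∧ P ≠ ⊥ := by
      intro I P hP
      have := prime_of_normalized_factor P hP
      exact ⟨Ideal.isPrime_of_prime this, this.ne_zero⟩
    have hcount : ∀ P : Ideal (𝓞 K), P.IsPrime → P ≠ ⊥ → ∃ p k : ℕ, 0 < k ∧ ∀ I : Ideal (𝓞 K),
        ((((normalizedFactors I).filter (lab · = lab P)).map Ideal.absNorm).prod).factorization p =
        (normalizedFactors I).count P * k := by
      intro P hP hP0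
      have := hP.isMaximal hP0
      obtain ⟨p, k, hk, -, hp, hpk⟩ := Ideal.exists_prime_and_absNorm_eq_pow P
      refine ⟨p, k, hk, fun I => ?_⟩
      have hfac : ∀ s : Multiset (Ideal (𝓞 K)), (∀ Q ∈ s, Q.IsPrime ∧ Q ≠ ⊥) →
          (((s.filter (lab · = lab P)).map Ideal.absNorm).prod).factorization p =
            s.count P * k := by
        intro s
        induction s using Multiset.induction_on with
        | empty => simp
        | cons Q s ih =>
          intro hs
          have ih' := ih (fun Q hQ => hs Q (Multiset.mem_cons_of_mem hQ))
          have hQ := hs Q (Multiset.mem_cons_self Q s)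
          have hne : ((s.filter (lab · = lab P)).map Ideal.absNorm).prod ≠ 0 := by
            refine Multiset.prod_ne_zero ?_
            intro h0
            obtain ⟨R, hR, hR0⟩ := Multiset.mem_map.mp h0
            rw [Ideal.absNorm_eq_zero_iff] at hR0
            exact (hs R (Multiset.mem_cons_of_mem (Multiset.mem_filter.mp hR).1)).2 hR0
          by_cases hl : lab Q = lab P
          · rw [Multiset.filter_cons_of_pos (p := (lab · = lab P)) _ hl, Multiset.map_cons, Multiset.prod_cons,
              Nat.factorization_mul (by rw [Ne, Ideal.absNorm_eq_zero_iff]; exact hQ.2) hne,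
              Finsupp.add_apply, ih']
            by_cases hQP : Q = P
            · subst hQP
              rw [hpk, hp.factorization_pow, Multiset.count_cons_self]
              simp; ring
            · rw [Multiset.count_cons_of_ne (Ne.symm hQP), Nat.factorization_eq_zero_of_not_dvd,
                zero_add]
              intro hd
              exact hQP (hlab p Q P hp hQ.1 hQ.2 hP hP0 hd (hpk ▸ dvd_pow_self p hk.ne') hl)
          · rw [Multiset.filter_cons_of_neg (p := (lab · = lab P)) _ hl, ih', Multiset.count_cons_of_ne]
            rintro rfl
            exact hl rfl
      exact hfac _ (fun Q hQ => hprime hQ)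
    rw [← Ideal.prod_normalizedFactors_eq_self hI, ← Ideal.prod_normalizedFactors_eq_self hJ]
    congr 1
    ext P
    by_cases hP : P.IsPrime ∧ P ≠ ⊥
    · obtain ⟨p, k, hk, h⟩ := hcount P hP.1 hP.2
      have := congrFun hIJ (lab P)
      simp only at this
      have h2 := h I
      rw [this, h J] at h2
      exact (Nat.eq_of_mul_eq_mul_right hk h2).symm
    · rw [Multiset.count_eq_zero_of_notMem fun h => hP (hprime h),
        Multiset.count_eq_zero_of_notMem fun h => hP (hprime h)]

/-- The number of ideals of norm at most `B` is `O(B ^ (1 + ε))`, with a constant depending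
only on `ε` and the degree. -/
lemma exists_card_ideal_le (d : ℕ) {ε : ℝ} (hε : 0 < ε) :
    ∃ C : ℝ, 0 < C ∧ ∀ (K : Type) (_ : Field K) (_ : NumberField K), Module.finrank ℚ K = d →
      ∀ (S : Finset (Ideal (𝓞 K))) (B : ℝ), 0 ≤ B →
        (∀ I ∈ S, I ≠ ⊥ ∧ (Ideal.absNorm I : ℝ) ≤ B) → (S.card : ℝ) ≤ C * B ^ (1 + ε) := by
  classical
  have hsum : Summable fun n : ℕ => (n : ℝ) ^ (-(1 + ε)) :=
    Real.summable_nat_rpow.mpr (by linarith)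
  set Z := ∑' n : ℕ, (n : ℝ) ^ (-(1 + ε)) with hZ
  have hZ0 : 0 < Z := by
    refine hsum.tsum_pos (fun n => by positivity) 1 (by simp)
  refine ⟨Z ^ d, by positivity, ?_⟩
  rintro K _ _ rfl S B hB hS
  obtain ⟨Φ, hprod, hinj⟩ := exists_ideal_encoding K
  set T := Finset.range (⌊B⌋₊ + 1) with hT
  have hmem : ∀ I ∈ S, Φ I ∈ Fintype.piFinset fun _ : Fin (Module.finrank ℚ K) => T := by
    intro I hI
    rw [Fintype.mem_piFinset]
    intro i
    have h1 : Φ I i ∣ Ideal.absNorm I := by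
      rw [← hprod I (hS I hI).1]
      exact Finset.dvd_prod_of_mem _ (Finset.mem_univ i)
    have h0 : 0 < Ideal.absNorm I := by
      rw [Nat.pos_iff_ne_zero, Ne, Ideal.absNorm_eq_zero_iff]; exact (hS I hI).1
    have := (Nat.le_of_dvd h0 h1).trans (Nat.le_floor (hS I hI).2)
    simp only [hT, Finset.mem_range]; omega
  have hone : ∀ I ∈ S, (1 : ℝ) ≤ B ^ (1 + ε) * ∏ i, ((Φ I i : ℝ) ^ (-(1 + ε))) := by
    intro I hI
    have h0 : 0 < Ideal.absNorm I := by
      rw [Nat.pos_iff_ne_zero, Ne, Ideal.absNorm_eq_zero_iff]; exact (hS I hI).1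
    have h0' : (0 : ℝ) < Ideal.absNorm I := by exact_mod_cast h0
    rw [Real.finsetProd_rpow _ _ (fun i _ => by positivity), ← Nat.cast_prod,
      hprod I (hS I hI).1, Real.rpow_neg h0'.le, ← div_eq_mul_inv, one_le_div (by positivity)]
    exact Real.rpow_le_rpow h0'.le (hS I hI).2 (by linarith)
  calc (S.card : ℝ) = ∑ I ∈ S, (1 : ℝ) := by simp
    _ ≤ ∑ I ∈ S, B ^ (1 + ε) * ∏ i, ((Φ I i : ℝ) ^ (-(1 + ε))) := Finset.sum_le_sum hone
    _ = B ^ (1 + ε) * ∑ I ∈ S, ∏ i, ((Φ I i : ℝ) ^ (-(1 + ε))) := by rw [Finset.mul_sum]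
    _ = B ^ (1 + ε) * ∑ x ∈ S.image Φ, ∏ i, ((x i : ℝ) ^ (-(1 + ε))) := by
      rw [Finset.sum_image]
      exact hinj.mono fun I hI => (hS I hI).1
    _ ≤ B ^ (1 + ε) * ∑ x ∈ Fintype.piFinset fun _ : Fin (Module.finrank ℚ K) => T,
        ∏ i, ((x i : ℝ) ^ (-(1 + ε))) := by
      refine mul_le_mul_of_nonneg_left (Finset.sum_le_sum_of_subset_of_nonneg ?_ ?_)
        (by positivity)
      · intro x hx
        obtain ⟨I, hI, rfl⟩ := Finset.mem_image.mp hx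
        exact hmem I hI
      · intro x _ _
        exact Finset.prod_nonneg fun i _ => by positivity
    _ = B ^ (1 + ε) * (∑ n ∈ T, (n : ℝ) ^ (-(1 + ε))) ^ Module.finrank ℚ K := by
      rw [Finset.sum_prod_piFinset T (fun _ n => (n : ℝ) ^ (-(1 + ε))), Finset.prod_const]
      simp
    _ ≤ B ^ (1 + ε) * Z ^ Module.finrank ℚ K := by
      have : ∑ n ∈ T, (n : ℝ) ^ (-(1 + ε)) ≤ Z :=
        hsum.sum_le_tsum T fun n _ => by positivity
      gcongr
    _ = _ := mul_comm _ _

open ArithmeticFunction ArithmeticFunction.vonMangoldt Filter Topology in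
lemma tsum_residueClass_eq {q : ℕ} [NeZero q] {a : ZMod q} (ha : IsUnit a) {x : ℝ} (hx : 1 < x) :
    (Summable fun n : ℕ => residueClass a n / (n : ℝ) ^ x) ∧
    ∑' n, residueClass a n / (n : ℝ) ^ x =
        (LFunctionResidueClassAux a x).re + (q.totient : ℝ)⁻¹ / (x - 1) := by
  constructor
  · have h := LSeriesSummable_of_abscissaOfAbsConv_lt_re (s := (x : ℂ)) <|
      (abscissaOfAbsConv_residueClass_le_one a).trans_lt <| by
        rw [Complex.ofReal_re]; exact_mod_cast hx
    refine Complex.summable_ofReal.mp (h.congr fun n => ?_)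
    rcases eq_or_ne n 0 with rfl | hn
    · simp
    · simp only [LSeries.term_of_ne_zero hn, ← Complex.ofReal_natCast n,
        ← Complex.ofReal_cpow n.cast_nonneg, ← Complex.ofReal_div]
  · refine Complex.ofReal_injective ?_
    simp only [Complex.ofReal_tsum, Complex.ofReal_div, Complex.ofReal_cpow (Nat.cast_nonneg _),
      Complex.ofReal_natCast, Complex.ofReal_add, Complex.ofReal_inv, Complex.ofReal_sub,
      Complex.ofReal_one]
    simp_rw [← LFunctionResidueClassAux_real ha hx,
      eqOn_LFunctionResidueClassAux ha <| Set.mem_ofPred.mpr (Complex.ofReal_re x ▸ hx),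
      sub_add_cancel, LSeries, LSeries.term]
    refine tsum_congr fun n ↦ ?_
    split_ifs with hn
    · simp only [hn, residueClass_apply_zero, Complex.ofReal_zero, zero_div]
    · rfl

open ArithmeticFunction.vonMangoldt in
/-- The von Mangoldt function divided by `n`, restricted to primes in the residue class `a`. -/
noncomputable def primeWeight {q : ℕ} (a : ZMod q) (n : ℕ) : ℝ :=
  (if n.Prime then residueClass a n else 0) / n

open ArithmeticFunction.vonMangoldt in
lemma primeWeight_nonneg {q : ℕ} (a : ZMod q) (n : ℕ) : 0 ≤ primeWeight a n := by
  unfold primeWeight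
  have := residueClass_nonneg a n
  split_ifs <;> positivity

lemma primeWeight_eq_zero {q : ℕ} {a : ZMod q} {n : ℕ} (h : ¬ (n.Prime ∧ (n : ZMod q) = a)) :
    primeWeight a n = 0 := by
  by_contra h'
  have : n ∈ Function.support (primeWeight a) := h'
  unfold primeWeight at this
  rw [ArithmeticFunction.vonMangoldt.support_residueClass_prime_div] at this
  exact h this

lemma primeWeight_le {q : ℕ} (a : ZMod q) {n : ℕ} (hn : 1 ≤ n) :
    primeWeight a n ≤ Real.log n / n := by
  unfold primeWeight
  gcongr
  split_ifs
  · exact (ArithmeticFunction.vonMangoldt.residueClass_le a n).trans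
      ArithmeticFunction.vonMangoldt_le_log
  · exact Real.log_nonneg (by exact_mod_cast hn)

open ArithmeticFunction.vonMangoldt in
lemma summable_primeWeight_rpow {q : ℕ} [NeZero q] {a : ZMod q} (ha : IsUnit a) {u : ℝ}
    (hu : 0 < u) : Summable fun n : ℕ => primeWeight a n * (n : ℝ) ^ (-u) := by
  refine Summable.of_nonneg_of_le (fun n => mul_nonneg (primeWeight_nonneg a n) (by positivity))
    (fun n => ?_) (tsum_residueClass_eq ha (x := 1 + u) (by linarith)).1
  rcases Nat.eq_zero_or_pos n with rfl | hn
  · simp [primeWeight]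
  have hn' : (0 : ℝ) < n := by exact_mod_cast hn
  have h0 := residueClass_nonneg a n
  rw [Real.rpow_add hn', Real.rpow_one, Real.rpow_neg hn'.le, ← div_eq_mul_inv, primeWeight,
    div_div]
  gcongr
  split_ifs
  · exact le_rfl
  · exact h0

open ArithmeticFunction.vonMangoldt Filter Topology in
lemma tendsto_primeWeight {q : ℕ} [NeZero q] {a : ZMod q} (ha : IsUnit a) :
    Tendsto (fun u : ℝ => u * ∑' n : ℕ, primeWeight a n * (n : ℝ) ^ (-u)) (𝓝[>] 0)
      (𝓝 (q.totient : ℝ)⁻¹) := by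
  set R : ℕ → ℝ := fun n => (if n.Prime then 0 else residueClass a n) / n with hR
  have hRs : Summable R := summable_residueClass_non_primes_div a
  have hR0 : ∀ n, 0 ≤ R n := fun n => by
    have := residueClass_nonneg a n
    simp only [hR]; split_ifs <;> positivity
  have hle : ∀ u : ℝ, 0 < u → ∀ n : ℕ, R n * (n : ℝ) ^ (-u) ≤ R n := fun u hu n => by
    rcases Nat.eq_zero_or_pos n with rfl | hn
    · simp [hR]
    · exact mul_le_of_le_one_right (hR0 n)
        (Real.rpow_le_one_of_one_le_of_nonpos (by exact_mod_cast hn) (by linarith))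
  have hRu : ∀ u : ℝ, 0 < u → Summable fun n : ℕ => R n * (n : ℝ) ^ (-u) := fun u hu =>
    Summable.of_nonneg_of_le (fun n => mul_nonneg (hR0 n) (by positivity)) (hle u hu) hRs
  have hcont : ContinuousOn (fun x : ℝ ↦ (LFunctionResidueClassAux a x).re) (Set.Ici 1) :=
    Complex.continuous_re.continuousOn.comp (t := Set.univ) (continuousOn_LFunctionResidueClassAux a)
      (fun ⦃x⦄ a ↦ trivial) |>.comp Complex.continuous_ofReal.continuousOn fun x hx ↦ by
        have := Set.mem_Ici.mp hx
        simpa only [Set.mem_ofPred_eq, Complex.ofReal_re] using this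
  have h1 : Tendsto (fun u : ℝ => (LFunctionResidueClassAux a ((1 + u : ℝ) : ℂ)).re) (𝓝[>] 0)
      (𝓝 (LFunctionResidueClassAux a ((1 : ℝ) : ℂ)).re) := by
    have := (hcont 1 (by simp)).tendsto
    refine this.comp (tendsto_nhdsWithin_iff.mpr ⟨?_, ?_⟩)
    · have : Tendsto (fun u : ℝ => 1 + u) (𝓝 0) (𝓝 (1 + 0)) := by
        exact (continuous_const.add continuous_id).tendsto 0
      rw [add_zero] at this
      exact this.mono_left nhdsWithin_le_nhds
    · filter_upwards [self_mem_nhdsWithin] with u hu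
      have : (0 : ℝ) < u := hu
      simp only [Set.mem_Ici]; linarith
  have hid : Tendsto (fun u : ℝ => u) (𝓝[>] 0) (𝓝 0) := tendsto_id.mono_left nhdsWithin_le_nhds
  have h2 : Tendsto (fun u : ℝ => u * ∑' n : ℕ, R n * (n : ℝ) ^ (-u)) (𝓝[>] 0) (𝓝 0) := by
    refine squeeze_zero' (g := fun u : ℝ => u * ∑' n, R n) ?_ ?_ ?_
    · filter_upwards [self_mem_nhdsWithin] with u hu
      exact mul_nonneg (le_of_lt hu) (tsum_nonneg fun n => mul_nonneg (hR0 n) (by positivity))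
    · filter_upwards [self_mem_nhdsWithin] with u hu
      exact mul_le_mul_of_nonneg_left ((hRu u hu).tsum_le_tsum (hle u hu) hRs) (le_of_lt hu)
    · simpa using hid.mul_const (∑' n, R n)
  have h3 := ((hid.mul h1).add_const ((q.totient : ℝ)⁻¹)).sub h2
  rw [zero_mul, zero_add, sub_zero] at h3
  refine h3.congr' ?_
  filter_upwards [self_mem_nhdsWithin] with u hu
  have hu : 0 < u := hu
  have key := (tsum_residueClass_eq ha (x := 1 + u) (by linarith)).2
  have hsplit : ∀ n : ℕ, residueClass a n / (n : ℝ) ^ (1 + u) =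
      primeWeight a n * (n : ℝ) ^ (-u) + R n * (n : ℝ) ^ (-u) := fun n => by
    rcases Nat.eq_zero_or_pos n with rfl | hn
    · simp [primeWeight, hR]
    have hn' : (0 : ℝ) < n := by exact_mod_cast hn
    rw [Real.rpow_add hn', Real.rpow_one, Real.rpow_neg hn'.le, primeWeight]
    simp only [hR]
    split_ifs <;> field_simp <;> ring
  rw [tsum_congr hsplit, (summable_primeWeight_rpow ha hu).tsum_add (hRu u hu)] at key
  have : ∑' n : ℕ, primeWeight a n * (n : ℝ) ^ (-u) =
    (LFunctionResidueClassAux a ((1 + u : ℝ) : ℂ)).re + (q.totient : ℝ)⁻¹ / u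
      - ∑' n : ℕ, R n * (n : ℝ) ^ (-u) := by
    rw [add_sub_cancel_left] at key
    linarith
  rw [this]
  field_simp

open Filter Topology in
/-- Convergence of polynomial test functions (the moment form of Karamata's theorem). -/
lemma tendsto_primeWeight_polynomial {q : ℕ} [NeZero q] {a : ZMod q} (ha : IsUnit a) (P : ℝ[X]) :
    (∀ u : ℝ, 0 < u → Summable fun n : ℕ =>
      primeWeight a n * ((n : ℝ) ^ (-u) * P.eval ((n : ℝ) ^ (-u)))) ∧
    Tendsto (fun u : ℝ => u * ∑' n : ℕ,
      primeWeight a n * ((n : ℝ) ^ (-u) * P.eval ((n : ℝ) ^ (-u)))) (𝓝[>] 0)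
      (𝓝 ((q.totient : ℝ)⁻¹ * ∫ t in (0 : ℝ)..1, P.eval t)) := by
  induction P using Polynomial.induction_on' with
  | add P Q hP hQ =>
    have hsum : ∀ u : ℝ, ∀ n : ℕ,
        primeWeight a n * ((n : ℝ) ^ (-u) * (P + Q).eval ((n : ℝ) ^ (-u))) =
        primeWeight a n * ((n : ℝ) ^ (-u) * P.eval ((n : ℝ) ^ (-u))) +
        primeWeight a n * ((n : ℝ) ^ (-u) * Q.eval ((n : ℝ) ^ (-u))) := fun u n => by
      rw [eval_add]; ring
    refine ⟨fun u hu => ((hP.1 u hu).add (hQ.1 u hu)).congr fun n => (hsum u n).symm, ?_⟩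
    have h_int : ∫ t in (0 : ℝ)..1, (P + Q).eval t =
        (∫ t in (0 : ℝ)..1, P.eval t) + ∫ t in (0 : ℝ)..1, Q.eval t := by
      simp_rw [eval_add]
      exact intervalIntegral.integral_add (P.continuous.intervalIntegrable _ _)
        (Q.continuous.intervalIntegrable _ _)
    rw [h_int, mul_add]
    refine (hP.2.add hQ.2).congr' ?_
    filter_upwards [self_mem_nhdsWithin] with u hu
    rw [tsum_congr (hsum u), (hP.1 u hu).tsum_add (hQ.1 u hu), mul_add]
  | monomial k c =>
    have hk : (0 : ℝ) < k + 1 := by positivity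
    have hterm : ∀ u : ℝ, ∀ n : ℕ,
        primeWeight a n * ((n : ℝ) ^ (-u) * (monomial k c).eval ((n : ℝ) ^ (-u))) =
        c * (primeWeight a n * (n : ℝ) ^ (-((k + 1) * u))) := fun u n => by
      rw [eval_monomial, ← Real.rpow_mul_natCast n.cast_nonneg]
      rcases Nat.eq_zero_or_pos n with rfl | hn
      · simp [primeWeight]
      have hn' : (0 : ℝ) < n := by exact_mod_cast hn
      rw [show -((k + 1) * u) = -u + -u * k by ring, Real.rpow_add hn']
      ring
    refine ⟨fun u hu => ((summable_primeWeight_rpow ha (mul_pos hk hu)).mul_left c).congr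
      fun n => (hterm u n).symm, ?_⟩
    have hlim := (tendsto_primeWeight ha).comp (f := fun u : ℝ => (k + 1) * u) (x := 𝓝[>] 0) <| by
      refine tendsto_nhdsWithin_iff.mpr ⟨?_, ?_⟩
      · have : Tendsto (fun u : ℝ => ((k : ℝ) + 1) * u) (𝓝 0) (𝓝 ((k + 1) * 0)) :=
          (continuous_const.mul continuous_id).tendsto 0
        rw [mul_zero] at this
        exact this.mono_left nhdsWithin_le_nhds
      · filter_upwards [self_mem_nhdsWithin] with u hu
        exact mul_pos hk hu
    have h_int : ∫ t in (0 : ℝ)..1, (monomial k c).eval t = c / (k + 1) := by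
      simp_rw [eval_monomial]
      rw [intervalIntegral.integral_const_mul, integral_pow]
      simp; ring
    rw [h_int]
    have := hlim.const_mul (c / ((k : ℝ) + 1))
    rw [mul_comm] at this
    refine this.congr' ?_
    filter_upwards with u
    rw [tsum_congr (hterm u), tsum_mul_left]
    simp only [Function.comp]
    field_simp

open Filter Topology in
/-- A lower bound for the number of primes in a residue class which loses only a small power. -/
lemma eventually_card_primes_ge {q : ℕ} [NeZero q] {a : ZMod q} (ha : IsUnit a) {ε : ℝ}
    (hε : 0 < ε) (hε1 : ε < 1) :
    ∃ c : ℝ, 0 < c ∧ ∀ᶠ X : ℝ in atTop, c * X ^ (1 - ε) ≤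
      (((Finset.Icc 1 ⌊X⌋₊).filter fun n : ℕ => n.Prime ∧ (n : ZMod q) = a).card : ℝ) := by
  set φ : ℝ := (q.totient : ℝ)⁻¹ with hφ
  have hφ0 : 0 < φ := by
    have := Nat.totient_pos.mpr q.pos_of_neZero
    positivity
  set A : ℝ := Real.exp (-1) with hA
  set B : ℝ := Real.exp (-(1 - ε)) with hB
  have hAB : A < B := Real.exp_lt_exp.mpr (by linarith)
  have hA0 : 0 < A := Real.exp_pos _
  have hB1 : B < 1 := by rw [hB, Real.exp_lt_one_iff]; linarith
  set g : ℝ → ℝ := fun t => max 0 (min (t - A) (B - t)) with hg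
  have hgc : Continuous g := by fun_prop
  have hg0 : ∀ t, 0 ≤ g t := fun t => le_max_left _ _
  have hgout : ∀ t, ¬ (A < t ∧ t < B) → g t = 0 := fun t ht => by
    refine max_eq_left ?_
    by_contra hh
    push Not at hh
    have := lt_min_iff.mp hh
    exact ht ⟨by linarith [this.1], by linarith [this.2]⟩
  have hg1 : ∀ t, 0 ≤ t → g t ≤ 1 := fun t ht => by
    refine max_le zero_le_one (min_le_of_right_le (by linarith))
  set I : ℝ := ∫ t in (0 : ℝ)..1, g t with hI
  have hIpos : 0 < I := by
    refine intervalIntegral.integral_pos zero_lt_one hgc.continuousOn (fun t _ => hg0 t)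
      ⟨(A + B) / 2, ⟨by linarith, by linarith⟩, ?_⟩
    exact lt_max_of_lt_right (lt_min (by linarith) (by linarith))
  obtain ⟨P, hP⟩ := exists_polynomial_near_of_continuousOn 0 1 g hgc.continuousOn (I / 4)
    (by linarith)
  have hPI : 3 / 4 * I ≤ ∫ t in (0 : ℝ)..1, P.eval t := by
    have h1 : ∫ t in (0 : ℝ)..1, (g t - I / 4) = I - I / 4 := by
      rw [intervalIntegral.integral_sub (hgc.intervalIntegrable _ _) (by simp)]
      simp [hI]
    have h2 : ∫ t in (0 : ℝ)..1, (g t - I / 4) ≤ ∫ t in (0 : ℝ)..1, P.eval t := by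
      refine intervalIntegral.integral_mono_on zero_le_one
        ((hgc.sub continuous_const).intervalIntegrable _ _)
        (P.continuous.intervalIntegrable _ _) fun t ht => ?_
      have := abs_lt.mp (hP t ht)
      linarith [this.1]
    linarith
  have hlim := ((tendsto_primeWeight_polynomial ha P).2).sub
    ((tendsto_primeWeight ha).const_mul (I / 4))
  have hev : ∀ᶠ u : ℝ in 𝓝[>] 0, φ * I / 4 < u * ∑' n : ℕ,
      primeWeight a n * ((n : ℝ) ^ (-u) * P.eval ((n : ℝ) ^ (-u))) -
      I / 4 * (u * ∑' n : ℕ, primeWeight a n * (n : ℝ) ^ (-u)) := by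
    refine hlim.eventually_const_lt ?_
    have := mul_le_mul_of_nonneg_left hPI hφ0.le
    nlinarith [mul_pos hφ0 hIpos]
  have hX : Tendsto (fun X : ℝ => (Real.log X)⁻¹) atTop (𝓝[>] 0) :=
    tendsto_inv_atTop_nhdsGT_zero.comp Real.tendsto_log_atTop
  refine ⟨φ * I / 4, by positivity, ?_⟩
  filter_upwards [hX.eventually hev, eventually_gt_atTop (Real.exp 1)] with X hX1 hXe
  have hX1' : 1 < X := lt_trans (by rw [Real.one_lt_exp_iff]; norm_num) hXe
  have hX0 : 0 < X := by linarith
  set L := Real.log X with hL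
  have hL1 : 0 < L := Real.log_pos hX1'
  set u := L⁻¹ with hu
  have hu0 : 0 < u := inv_pos.mpr hL1
  set S := (Finset.Icc 1 ⌊X⌋₊).filter fun n : ℕ => n.Prime ∧ (n : ZMod q) = a with hS
  have hterm : ∀ n : ℕ, primeWeight a n * ((n : ℝ) ^ (-u) * P.eval ((n : ℝ) ^ (-u))) -
      I / 4 * (primeWeight a n * (n : ℝ) ^ (-u)) ≤
      if n ∈ S then L / X ^ (1 - ε) else 0 := by
    intro n
    by_cases hn : n.Prime ∧ (n : ZMod q) = a
    swap
    · rw [primeWeight_eq_zero hn]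
      simp only [zero_mul, mul_zero, sub_zero]
      split_ifs <;> positivity
    have hn1 : 1 ≤ n := hn.1.one_lt.le
    have hn0 : (0 : ℝ) < n := by exact_mod_cast hn1
    set t := (n : ℝ) ^ (-u) with ht
    have ht0 : 0 < t := by positivity
    have ht1 : t ≤ 1 := Real.rpow_le_one_of_one_le_of_nonpos (by exact_mod_cast hn1) (by linarith)
    have hw := primeWeight_nonneg a n
    have hgt : P.eval t - I / 4 ≤ g t := by
      have := abs_lt.mp (hP t ⟨ht0.le, ht1⟩)
      linarith [this.2]
    have hle : primeWeight a n * (t * P.eval t) - I / 4 * (primeWeight a n * t) ≤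
        primeWeight a n * (t * g t) := by
      have : primeWeight a n * (t * P.eval t) - I / 4 * (primeWeight a n * t) =
        primeWeight a n * (t * (P.eval t - I / 4)) := by ring
      rw [this]
      gcongr
    refine hle.trans ?_
    by_cases htAB : A < t ∧ t < B
    swap
    · rw [hgout t htAB, mul_zero, mul_zero]
      split_ifs <;> positivity
    have htexp : t = Real.exp (Real.log n * (-u)) := Real.rpow_def_of_pos hn0 _
    have hlogn : Real.log n < L := by
      have h := htAB.1
      rw [htexp, hA, Real.exp_lt_exp, hu, mul_neg, neg_lt_neg_iff, ← div_eq_mul_inv,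
        div_lt_one hL1] at h
      exact h
    have hlogn' : (1 - ε) * L < Real.log n := by
      have h := htAB.2
      rw [htexp, hB, Real.exp_lt_exp, hu, mul_neg, neg_lt_neg_iff, ← div_eq_mul_inv,
        lt_div_iff₀ hL1] at h
      exact h
    have hnX : (n : ℝ) < X := (Real.log_lt_log_iff hn0 hX0).mp hlogn
    have hnX' : X ^ (1 - ε) ≤ n := by
      rw [← Real.log_le_log_iff (by positivity) hn0, Real.log_rpow hX0]
      exact hlogn'.le
    have hnS : n ∈ S := by
      simp only [hS, Finset.mem_filter, Finset.mem_Icc]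
      exact ⟨⟨hn1, Nat.le_floor hnX.le⟩, hn⟩
    rw [if_pos hnS]
    calc primeWeight a n * (t * g t) ≤ primeWeight a n * (1 * 1) := by
          gcongr
          exact hg1 t ht0.le
      _ ≤ Real.log n / n := by simpa using primeWeight_le a hn1
      _ ≤ L / X ^ (1 - ε) := by gcongr
  have hs1 := (tendsto_primeWeight_polynomial ha P).1 u hu0
  have hs2 := (summable_primeWeight_rpow ha hu0).mul_left (I / 4)
  have hfin : HasSum (fun n => if n ∈ S then L / X ^ (1 - ε) else 0)
      (∑ n ∈ S, if n ∈ S then L / X ^ (1 - ε) else 0) :=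
    hasSum_sum_of_ne_finset_zero fun n hn => if_neg hn
  have hle := (hs1.sub hs2).tsum_le_tsum hterm hfin.summable
  rw [hfin.tsum_eq, hs1.tsum_sub hs2, tsum_mul_left, Finset.sum_congr rfl (g := fun _ =>
    L / X ^ (1 - ε)) (fun n hn => if_pos hn), Finset.sum_const, nsmul_eq_mul] at hle
  have h3 : φ * I / 4 < u * (S.card * (L / X ^ (1 - ε))) := by
    refine hX1.trans_le ?_
    calc _ = u * (∑' n : ℕ, primeWeight a n * ((n : ℝ) ^ (-u) * P.eval ((n : ℝ) ^ (-u))) -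
        I / 4 * ∑' n : ℕ, primeWeight a n * (n : ℝ) ^ (-u)) := by ring
      _ ≤ _ := mul_le_mul_of_nonneg_left hle hu0.le
  have h4 : u * (S.card * (L / X ^ (1 - ε))) = S.card / X ^ (1 - ε) := by
    rw [hu]; field_simp
  rw [h4, lt_div_iff₀ (by positivity)] at h3
  exact h3.le

open Filter Topology in
lemma eventually_mul_log_add_le_rpow (A B : ℝ) {η : ℝ} (hη : 0 < η) :
    ∀ᶠ D : ℝ in atTop, A * Real.log D + B ≤ D ^ η := by
  have h1 : (fun D : ℝ => A * Real.log D + B) =o[atTop] fun D : ℝ => D ^ η :=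
    ((isLittleO_log_rpow_atTop hη).const_mul_left A).add
      (Asymptotics.isLittleO_const_left.mpr (Or.inr (by
        exact tendsto_norm_atTop_atTop.comp (tendsto_rpow_atTop hη))))
  filter_upwards [h1.bound one_pos, eventually_ge_atTop 0] with D hD hD0
  rw [one_mul, Real.norm_of_nonneg (Real.rpow_nonneg hD0 η)] at hD
  exact (Real.le_norm_self _).trans hD

open Filter Topology in
lemma eventually_mul_log_add_pow_le_rpow (A B : ℝ) (hA : 0 ≤ A) (hB : 0 ≤ B) {η : ℝ} (hη : 0 < η)
    {d : ℕ} (hd : d ≠ 0) :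
    ∀ᶠ D : ℝ in atTop, (A * Real.log D + B) ^ d ≤ D ^ η := by
  have hd' : (0 : ℝ) < d := by positivity
  filter_upwards [eventually_mul_log_add_le_rpow A B (η := η / d) (by positivity),
    eventually_ge_atTop 1] with D hD hD1
  have h0 := Real.log_nonneg hD1
  calc (A * Real.log D + B) ^ d ≤ (D ^ (η / d)) ^ d := by gcongr
    _ = D ^ η := by
      rw [← Real.rpow_natCast, ← Real.rpow_mul (by linarith)]
      congr 1
      field_simp

lemma four_mul_rpow_pow {D : ℝ} (hD : 0 ≤ D) {d : ℕ} (hd : d ≠ 0) :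
    (4 * D ^ (1 / (2 * (d : ℝ)))) ^ d = 4 ^ d * √D := by
  have hd' : (d : ℝ) ≠ 0 := by positivity
  rw [mul_pow, ← Real.rpow_natCast (D ^ _), ← Real.rpow_mul hD, Real.sqrt_eq_rpow]
  congr 2
  field_simp

lemma log_four_mul_rpow {D : ℝ} (hD : 1 ≤ D) (d : ℕ) :
    Real.log (4 * D ^ (1 / (2 * (d : ℝ)))) = 1 / (2 * (d : ℝ)) * Real.log D + Real.log 4 := by
  have : 0 < D := by linarith
  rw [Real.log_mul (by norm_num) (by positivity), Real.log_rpow this]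
  ring

/-- Minkowski's theorem for a nonzero integral ideal and a box with prescribed side lengths. -/
lemma exists_mem_ideal_forall_place_lt {K : Type*} [Field K] [NumberField K] {I : Ideal (𝓞 K)}
    (hI : I ≠ ⊥) {f : InfinitePlace K → ℝ} (hf : ∀ w, 0 < f w)
    (h : 2 ^ Module.finrank ℚ K * Ideal.absNorm I * √(DK K) < ∏ w, f w ^ w.mult) :
    ∃ x ∈ I, x ≠ 0 ∧ ∀ w : InfinitePlace K, w (x : K) < f w := by
  classical
  let I' := FractionalIdeal.mk0 K ⟨I, mem_nonZeroDivisors_of_ne_zero hI⟩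
  let f' : InfinitePlace K → NNReal := fun w => ⟨f w, (hf w).le⟩
  have hlt : mixedEmbedding.minkowskiBound K I' <
      MeasureTheory.volume (mixedEmbedding.convexBodyLT K f') := by
    rw [mixedEmbedding.minkowskiBound,
      mixedEmbedding.volume_fundamentalDomain_fractionalIdealLatticeBasis,
      mixedEmbedding.volume_fundamentalDomain_latticeBasis, mixedEmbedding.finrank,
      mixedEmbedding.convexBodyLT_volume]
    have h1 : FractionalIdeal.absNorm (I' : FractionalIdeal (nonZeroDivisors (𝓞 K)) K) =
        (Ideal.absNorm I : ℚ) := by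
      rw [FractionalIdeal.coe_mk0, FractionalIdeal.coeIdeal_absNorm]
    have h2 : √‖discr K‖ = √(DK K) := by
      rw [Int.norm_eq_abs, DK, Nat.cast_natAbs, Int.cast_abs]
    have h3 : 2 ^ Module.finrank ℚ K * (Ideal.absNorm I : NNReal) * NNReal.sqrt ‖discr K‖₊ <
        ∏ w, f' w ^ w.mult := by
      rw [← NNReal.coe_lt_coe]
      push_cast
      rw [h2]
      exact h
    have h4 : ENNReal.ofReal ((Ideal.absNorm I : ℚ) : ℝ) = ((Ideal.absNorm I : NNReal) : ENNReal) := by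
      rw [Rat.cast_natCast, ENNReal.ofReal_natCast]; simp
    rw [h1, h4]
    calc ((Ideal.absNorm I : NNReal) : ENNReal) * (2⁻¹ ^ InfinitePlace.nrComplexPlaces K *
          (NNReal.sqrt ‖discr K‖₊ : NNReal)) * 2 ^ Module.finrank ℚ K
        ≤ ((Ideal.absNorm I : NNReal) : ENNReal) * (1 *
          (NNReal.sqrt ‖discr K‖₊ : NNReal)) * 2 ^ Module.finrank ℚ K := by
          gcongr
          exact pow_le_one₀ (by simp) (by simp)
      _ = ((2 ^ Module.finrank ℚ K * (Ideal.absNorm I : NNReal) * NNReal.sqrt ‖discr K‖₊ : NNReal) :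
          ENNReal) := by push_cast; ring
      _ < ((∏ w, f' w ^ w.mult : NNReal) : ENNReal) := by exact_mod_cast h3
      _ ≤ (mixedEmbedding.convexBodyLTFactor K : ENNReal) * ((∏ w, f' w ^ w.mult : NNReal) : ENNReal) :=
          le_mul_of_one_le_left (by simp)
            (by exact_mod_cast mixedEmbedding.one_le_convexBodyLTFactor (K := K))
  obtain ⟨a, haI, ha0, ha⟩ := mixedEmbedding.exists_ne_zero_mem_ideal_lt K I' hlt
  rw [FractionalIdeal.coe_mk0, FractionalIdeal.mem_coeIdeal] at haI
  obtain ⟨x, hx, rfl⟩ := haI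
  exact ⟨x, hx, fun h0 => ha0 (by rw [h0, map_zero]), ha⟩

lemma prod_place_pow_mult_eq_absNorm {K : Type*} [Field K] [NumberField K] (x : 𝓞 K) :
    ∏ w : InfinitePlace K, w (x : K) ^ w.mult = (Ideal.absNorm (Ideal.span {x}) : ℝ) := by
  rw [InfinitePlace.prod_eq_abs_norm, Ideal.absNorm_span_singleton, ← Algebra.coe_norm_int]
  rw [Nat.cast_natAbs]
  push_cast
  rfl

lemma exists_small_generator {K : Type*} [Field K] [NumberField K] {J P : Ideal (𝓞 K)} {γ : 𝓞 K}
    {ℓ : ℕ} {Λ : ℝ} (hJ : J ≠ ⊥) (hP : P ≠ ⊥) (hγ : γ ≠ 0) (hℓ : 0 < ℓ) (hJγ : J ^ ℓ = Ideal.span {γ})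
    (hΛ : 1 < Λ) (hD : 2 ^ Module.finrank ℚ K * √(DK K) < Λ ^ Module.finrank ℚ K) :
    ∃ (x : 𝓞 K) (b : Ideal (𝓞 K)) (t : InfinitePlace K → ℝ), x ≠ 0 ∧ b ≠ ⊥ ∧
      Ideal.span {x} = J * P * b ∧ (Ideal.absNorm b : ℝ) ≤ Λ ^ Module.finrank ℚ K ∧
      ∀ w : InfinitePlace K, (Λ ^ Module.finrank ℚ K)⁻¹ ≤ t w ∧ t w ≤ Λ ∧
        w (x : K) ^ ℓ = t w ^ ℓ * ((Ideal.absNorm P : ℝ) ^ (ℓ / Module.finrank ℚ K : ℝ) * w (γ : K)) := by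
  set d := Module.finrank ℚ K with hd
  have hd0 : 0 < d := Module.finrank_pos
  have hℓ' : (ℓ : ℝ) ≠ 0 := by exact_mod_cast hℓ.ne'
  have hd' : (d : ℝ) ≠ 0 := by exact_mod_cast hd0.ne'
  have hΛ0 : 0 < Λ := by linarith
  have hNP : (0 : ℝ) < Ideal.absNorm P := by
    exact_mod_cast Nat.pos_of_ne_zero (by rwa [Ne, Ideal.absNorm_eq_zero_iff])
  have hNJ : (0 : ℝ) < Ideal.absNorm J := by
    exact_mod_cast Nat.pos_of_ne_zero (by rwa [Ne, Ideal.absNorm_eq_zero_iff])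
  have hγw : ∀ w : InfinitePlace K, 0 < w (γ : K) := fun w =>
    InfinitePlace.pos_iff.mpr (RingOfIntegers.coe_ne_zero_iff.mpr hγ)
  let g : InfinitePlace K → ℝ := fun w => (Ideal.absNorm P : ℝ) ^ (1 / d : ℝ) * w (γ : K) ^ (1 / ℓ : ℝ)
  have hg : ∀ w, 0 < g w := fun w =>
    mul_pos (Real.rpow_pos_of_pos hNP _) (Real.rpow_pos_of_pos (hγw w) _)
  have hgpow : ∀ w, g w ^ ℓ = (Ideal.absNorm P : ℝ) ^ (ℓ / d : ℝ) * w (γ : K) := by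
    intro w
    simp only [g]
    rw [mul_pow, ← Real.rpow_natCast, ← Real.rpow_natCast, ← Real.rpow_mul hNP.le,
      ← Real.rpow_mul (hγw w).le, one_div_mul_cancel hℓ', Real.rpow_one]
    congr 2; ring
  have hprodc : ∀ c : ℝ, ∏ w : InfinitePlace K, c ^ w.mult = c ^ d := fun c => by
    rw [Finset.prod_pow_eq_pow_sum, InfinitePlace.sum_mult_eq]
  have hgprod : ∏ w, g w ^ w.mult = Ideal.absNorm P * Ideal.absNorm J := by
    simp only [g, mul_pow]
    rw [Finset.prod_mul_distrib, hprodc, ← Real.rpow_natCast, ← Real.rpow_mul hNP.le,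
      one_div_mul_cancel hd', Real.rpow_one]
    congr 1
    have : ∀ w : InfinitePlace K, (w (γ : K) ^ (1 / ℓ : ℝ)) ^ w.mult =
        (w (γ : K) ^ w.mult) ^ (1 / ℓ : ℝ) := fun w => by
      rw [← Real.rpow_natCast, ← Real.rpow_natCast, ← Real.rpow_mul (hγw w).le, ← Real.rpow_mul (hγw w).le, mul_comm]
    rw [Finset.prod_congr rfl fun w _ => this w, Real.finsetProd_rpow _ _ (fun w _ => by positivity),
      prod_place_pow_mult_eq_absNorm, ← hJγ, map_pow]
    push_cast
    rw [one_div, Real.pow_rpow_inv_natCast hNJ.le hℓ.ne']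
  obtain ⟨x, hxI, hx0, hxw⟩ := exists_mem_ideal_forall_place_lt (I := J * P) (f := fun w => Λ * g w)
    (by rw [← Ideal.zero_eq_bot] at *; exact mul_ne_zero hJ hP) (fun w => mul_pos hΛ0 (hg w)) (by
      simp only [mul_pow]
      rw [Finset.prod_mul_distrib, hprodc, hgprod, map_mul]
      push_cast
      nlinarith [mul_pos hNP hNJ])
  obtain ⟨b, hb⟩ := Ideal.dvd_span_singleton.mpr hxI
  have hxw0 : ∀ w : InfinitePlace K, 0 < w (x : K) := fun w =>
    InfinitePlace.pos_iff.mpr (RingOfIntegers.coe_ne_zero_iff.mpr hx0)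
  let t : InfinitePlace K → ℝ := fun w => w (x : K) / g w
  have ht0 : ∀ w, 0 < t w := fun w => div_pos (hxw0 w) (hg w)
  have htΛ : ∀ w, t w ≤ Λ := fun w => by
    rw [div_le_iff₀ (hg w)]; exact (hxw w).le
  have hb0 : b ≠ ⊥ := by
    rintro rfl
    rw [Ideal.mul_bot, Ideal.span_singleton_eq_bot] at hb
    exact hx0 hb
  have hNb : (1 : ℝ) ≤ Ideal.absNorm b := by
    exact_mod_cast Nat.pos_of_ne_zero (by rwa [Ne, Ideal.absNorm_eq_zero_iff])
  have htprod : ∏ w, t w ^ w.mult = Ideal.absNorm b := by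
    simp only [t, div_pow]
    rw [Finset.prod_div_distrib, hgprod, prod_place_pow_mult_eq_absNorm, hb, map_mul, map_mul]
    push_cast
    field_simp
  refine ⟨x, b, t, hx0, hb0, hb, ?_, fun w => ⟨?_, htΛ w, ?_⟩⟩
  · rw [← htprod, ← hprodc]
    exact Finset.prod_le_prod (fun w _ => pow_nonneg (ht0 w).le _)
      fun w _ => pow_le_pow_left₀ (ht0 w).le (htΛ w) _
  · rcases le_or_gt 1 (t w) with h1 | h1
    · exact (inv_le_one_of_one_le₀ (one_le_pow₀ hΛ.le)).trans h1
    · classical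
      rw [← Finset.mul_prod_erase _ _ (Finset.mem_univ w)] at htprod
      have h2 : ∏ v ∈ Finset.univ.erase w, t v ^ v.mult ≤ Λ ^ d := by
        calc _ ≤ ∏ v ∈ Finset.univ.erase w, Λ ^ v.mult :=
              Finset.prod_le_prod (fun w _ => pow_nonneg (ht0 w).le _)
                fun w _ => pow_le_pow_left₀ (ht0 w).le (htΛ w) _
          _ ≤ Λ ^ w.mult * ∏ v ∈ Finset.univ.erase w, Λ ^ v.mult :=
              le_mul_of_one_le_left (by positivity) (one_le_pow₀ hΛ.le)
          _ = Λ ^ d := by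
              rw [Finset.mul_prod_erase _ (fun v : InfinitePlace K => Λ ^ v.mult) (Finset.mem_univ w), hprodc]
      have h3 : t w ^ w.mult ≤ t w := pow_le_of_le_one (ht0 w).le h1.le InfinitePlace.mult_ne_zero
      have h4 : 0 < t w ^ w.mult := pow_pos (ht0 w) _
      rw [inv_le_iff_one_le_mul₀ (by positivity)]
      calc (1 : ℝ) ≤ t w ^ w.mult * ∏ v ∈ Finset.univ.erase w, t v ^ v.mult := by rw [htprod]; exact hNb
        _ ≤ t w * Λ ^ d := mul_le_mul h3 h2
            (Finset.prod_nonneg fun v _ => pow_nonneg (ht0 v).le _) (ht0 w).le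
  · rw [← hgpow, ← mul_pow, div_mul_cancel₀ _ (hg w).ne']

/-- Pigeonhole principle: a family of ideals which cannot be connected by multiplicatively small
quotients bounds the `ℓ`-torsion of the class group. -/
lemma card_torsion_mul_card_le {K : Type*} [Field K] [NumberField K] {ℓ : ℕ} (hℓ : 0 < ℓ)
    {s : Finset (Ideal (𝓞 K))} (hs : ∀ P ∈ s, P ≠ ⊥)
    (hsep : ∀ P ∈ s, ∀ Q ∈ s, P ≠ Q → Ideal.absNorm P ≤ Ideal.absNorm Q →
      ∀ u v : 𝓞 K, u ≠ 0 → v ≠ 0 → Ideal.span {u} * Q ^ ℓ = Ideal.span {v} * P ^ ℓ →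
        ∃ w : InfinitePlace K, Real.exp ℓ * w (v : K) < w (u : K))
    {Λ M : ℝ} (hΛ : 1 < Λ) (hD : 2 ^ Module.finrank ℚ K * √(DK K) < Λ ^ Module.finrank ℚ K)
    (hM : ∀ S : Finset (Ideal (𝓞 K)),
      (∀ I ∈ S, I ≠ ⊥ ∧ (Ideal.absNorm I : ℝ) ≤ Λ ^ Module.finrank ℚ K) → (S.card : ℝ) ≤ M) :
    (Nat.card {c : ClassGroup (𝓞 K) // c ^ ℓ = 1} : ℝ) * s.card ≤
      M * ((Module.finrank ℚ K + 1) * Real.log Λ + 2) ^ Module.finrank ℚ K := by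
  classical
  set d := Module.finrank ℚ K with hd
  have hΛ0 : 0 < Λ := by linarith
  have hL : 0 < Real.log Λ := Real.log_pos hΛ
  have hJ : ∀ c : {c : ClassGroup (𝓞 K) // c ^ ℓ = 1}, ∃ (J : nonZeroDivisors (Ideal (𝓞 K))) (γ : 𝓞 K),
      γ ≠ 0 ∧ ClassGroup.mk0 J = c ∧ (J : Ideal (𝓞 K)) ^ ℓ = Ideal.span {γ} := by
    rintro ⟨c, hc⟩
    obtain ⟨J, rfl⟩ := ClassGroup.mk0_surjective c
    rw [← map_pow] at hc
    obtain ⟨γ, hγ⟩ := (ClassGroup.mk0_eq_one_iff (J ^ ℓ).2).mp hc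
    have hγ' : (J : Ideal (𝓞 K)) ^ ℓ = Ideal.span {γ} := hγ
    refine ⟨J, γ, ?_, rfl, hγ'⟩
    rintro rfl
    rw [Ideal.span_singleton_eq_bot.mpr rfl] at hγ'
    exact nonZeroDivisors.ne_zero J.2 (eq_zero_of_pow_eq_zero hγ')
  choose J γ hγ0 hJc hJγ using hJ
  have hJ0 : ∀ c, (J c : Ideal (𝓞 K)) ≠ ⊥ := fun c => nonZeroDivisors.ne_zero (J c).2
  have key := fun (i : {c : ClassGroup (𝓞 K) // c ^ ℓ = 1} × s) =>
    exists_small_generator (hJ0 i.1) (hs i.2 i.2.2) (hγ0 i.1) hℓ (hJγ i.1) hΛ hD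
  choose x b t hx0 hb0 hxb hNb ht hbound hxt using key
  have ht0 : ∀ i w, 0 < t i w := fun i w => lt_of_lt_of_le (by positivity) (ht i w)
  have hwpos : ∀ (w : InfinitePlace K) (y : 𝓞 K), y ≠ 0 → 0 < w (y : K) := fun w y hy =>
    InfinitePlace.pos_iff.mpr (RingOfIntegers.coe_ne_zero_iff.mpr hy)
  let F : {c : ClassGroup (𝓞 K) // c ^ ℓ = 1} × s → Ideal (𝓞 K) × (InfinitePlace K → ℤ) :=
    fun i => (b i, fun w => ⌊Real.log (t i w)⌋)
  have hratio : ∀ i j, F i = F j → ∀ w, t i w ≤ Real.exp 1 * t j w := by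
    intro i j hij w
    have h1 : ⌊Real.log (t i w)⌋ = ⌊Real.log (t j w)⌋ := congrFun (congrArg Prod.snd hij) w
    have h2 := Int.abs_sub_lt_one_of_floor_eq_floor h1
    rw [← Real.exp_log (ht0 i w), ← Real.exp_log (ht0 j w), ← Real.exp_add]
    exact Real.exp_le_exp.mpr (by linarith [(abs_lt.mp h2).2])
  have hsame : ∀ i j, F i = F j → Ideal.absNorm (i.2 : Ideal (𝓞 K)) ≤ Ideal.absNorm (j.2 : Ideal (𝓞 K)) →
      i.2 = j.2 := by
    intro i j hij hN
    by_contra hne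
    have hbb : b i = b j := congrArg Prod.fst hij
    obtain ⟨w, hw⟩ := hsep i.2 i.2.2 j.2 j.2.2 (fun h => hne (Subtype.ext h)) hN
      (x i ^ ℓ * γ j.1) (x j ^ ℓ * γ i.1) (mul_ne_zero (pow_ne_zero _ (hx0 i)) (hγ0 _))
      (mul_ne_zero (pow_ne_zero _ (hx0 j)) (hγ0 _)) (by
        simp only [← Ideal.span_singleton_mul_span_singleton, ← Ideal.span_singleton_pow]
        rw [hxb, hxb, ← hJγ, ← hJγ, hbb]
        ring)
    refine absurd hw (not_lt.mpr ?_)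
    push_cast
    rw [map_mul, map_mul, map_pow, map_pow, hxt, hxt]
    have hγi := hwpos w _ (hγ0 i.1)
    have hγj := hwpos w _ (hγ0 j.1)
    have hp : t i w ^ ℓ ≤ Real.exp ℓ * t j w ^ ℓ := by
      have := pow_le_pow_left₀ (ht0 i w).le (hratio i j hij w) ℓ
      rwa [mul_pow, ← Real.exp_nat_mul, mul_one] at this
    have hNN : (Ideal.absNorm (i.2 : Ideal (𝓞 K)) : ℝ) ^ (ℓ / d : ℝ) ≤
        (Ideal.absNorm (j.2 : Ideal (𝓞 K)) : ℝ) ^ (ℓ / d : ℝ) :=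
      Real.rpow_le_rpow (by positivity) (by exact_mod_cast hN) (by positivity)
    have htj := ht0 j w
    calc t i w ^ ℓ * ((Ideal.absNorm (i.2 : Ideal (𝓞 K)) : ℝ) ^ (ℓ / d : ℝ) * w (γ i.1 : K)) * w (γ j.1 : K)
        ≤ (Real.exp ℓ * t j w ^ ℓ) *
          ((Ideal.absNorm (j.2 : Ideal (𝓞 K)) : ℝ) ^ (ℓ / d : ℝ) * w (γ i.1 : K)) * w (γ j.1 : K) := by
          gcongr
      _ = _ := by ring
  have hinj : Function.Injective F := by
    intro i j hij
    have h2 : i.2 = j.2 := by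
      rcases le_total (Ideal.absNorm (i.2 : Ideal (𝓞 K))) (Ideal.absNorm (j.2 : Ideal (𝓞 K))) with h | h
      · exact hsame i j hij h
      · exact (hsame j i hij.symm h).symm
    have hbb : b i = b j := congrArg Prod.fst hij
    refine Prod.ext (Subtype.ext ?_) h2
    rw [← hJc i.1, ← hJc j.1, ClassGroup.mk0_eq_mk0_iff]
    refine ⟨x j, x i, hx0 j, hx0 i, ?_⟩
    rw [hxb, hxb, hbb, h2]
    ring
  have hmem : ∀ i ∈ (Finset.univ : Finset ({c : ClassGroup (𝓞 K) // c ^ ℓ = 1} × s)),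
      F i ∈ (Finset.univ.image b) ×ˢ (Fintype.piFinset fun _ : InfinitePlace K =>
        Finset.Icc ⌊-(d * Real.log Λ)⌋ ⌊Real.log Λ⌋) := by
    intro i _
    simp only [F, Finset.mem_product, Finset.mem_image, Finset.mem_univ, true_and,
      exists_apply_eq_apply, Fintype.mem_piFinset, Finset.mem_Icc]
    intro w
    constructor
    · apply Int.floor_le_floor
      rw [← Real.log_pow, ← Real.log_inv]
      exact Real.log_le_log (by positivity) (ht i w)
    · exact Int.floor_le_floor (Real.log_le_log (ht0 i w) (hbound i w))
  have hcard := Finset.card_le_card_of_injOn F hmem hinj.injOn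
  rw [Finset.card_product, Fintype.card_piFinset, Finset.prod_const, Finset.card_univ, Finset.card_univ,
    Fintype.card_prod,
    Fintype.card_coe, Int.card_Icc] at hcard
  have hM' := hM (Finset.univ.image b) (fun I hI => by
    obtain ⟨i, -, rfl⟩ := Finset.mem_image.mp hI
    exact ⟨hb0 i, hNb i⟩)
  have hM0 : 0 ≤ M := (Nat.cast_nonneg _).trans hM'
  have hicc : ((⌊Real.log Λ⌋ + 1 - ⌊-(d * Real.log Λ)⌋).toNat : ℝ) ≤ (d + 1) * Real.log Λ + 2 := by
    have h1 := Int.floor_le (Real.log Λ)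
    have h2 := Int.lt_floor_add_one (-(d * Real.log Λ))
    have h3 : (0 : ℝ) ≤ (d + 1) * Real.log Λ + 2 := by positivity
    rcases le_total 0 (⌊Real.log Λ⌋ + 1 - ⌊-(d * Real.log Λ)⌋) with h | h
    · have : ((⌊Real.log Λ⌋ + 1 - ⌊-(d * Real.log Λ)⌋).toNat : ℝ) =
          ((⌊Real.log Λ⌋ + 1 - ⌊-(d * Real.log Λ)⌋ : ℤ) : ℝ) := by
        exact_mod_cast Int.toNat_of_nonneg h
      rw [this]
      push_cast
      linarith
    · rw [Int.toNat_of_nonpos h]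
      simpa using h3
  have hplaces : Fintype.card (InfinitePlace K) ≤ d := by
    rw [hd, ← InfinitePlace.sum_mult_eq (K := K), ← Finset.card_univ, Finset.card_eq_sum_ones]
    exact Finset.sum_le_sum fun w _ => InfinitePlace.mult_pos
  rw [Nat.card_eq_fintype_card]
  calc (Fintype.card {c : ClassGroup (𝓞 K) // c ^ ℓ = 1} : ℝ) * s.card
      ≤ ((Finset.univ.image b).card : ℝ) *
        ((⌊Real.log Λ⌋ + 1 - ⌊-(d * Real.log Λ)⌋).toNat : ℝ) ^ Fintype.card (InfinitePlace K) := by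
        exact_mod_cast hcard
    _ ≤ M * ((d + 1) * Real.log Λ + 2) ^ Fintype.card (InfinitePlace K) := by gcongr
    _ ≤ M * ((d + 1) * Real.log Λ + 2) ^ d := by
        gcongr
        nlinarith

lemma absNorm_dvd_natAbs_det {S ι : Type*} [CommRing S] [IsDedekindDomain S] [Module.Free ℤ S]
    [Module.Finite ℤ S] [Fintype ι] [DecidableEq ι] (b : Module.Basis ι ℤ S) {I : Ideal S}
    (hI : I ≠ ⊥) {v : ι → S} (hv : ∀ i, v i ∈ I) : Ideal.absNorm I ∣ (b.det v).natAbs := by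
  let bI := I.selfBasis b hI
  let v' : ι → I := fun i => ⟨v i, hv i⟩
  have h1 : v = Subtype.val ∘ v' := rfl
  have h2 : b.toMatrix v = b.toMatrix (Subtype.val ∘ bI) * bI.toMatrix v' := by
    ext i j
    rw [Matrix.mul_apply, Module.Basis.toMatrix_apply]
    have h3 : v j = ∑ k, bI.repr (v' j) k • ((bI k : I) : S) := by
      conv_lhs => rw [h1, Function.comp_apply, ← bI.sum_repr (v' j)]
      push_cast
      rfl
    rw [h3, map_sum, Finsupp.finsetSum_apply]
    refine Finset.sum_congr rfl fun k _ => ?_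
    rw [map_smul, Finsupp.smul_apply, smul_eq_mul, mul_comm]
    rfl
  rw [b.det_apply, h2, Matrix.det_mul, ← b.det_apply, Int.natAbs_mul,
    Ideal.natAbs_det_basis_change b I bI]
  exact dvd_mul_right _ _

lemma coe_discr_int {K ι : Type*} [Field K] [NumberField K] [Fintype ι] [DecidableEq ι]
    (v : ι → 𝓞 K) : ((Algebra.discr ℤ v : ℤ) : ℚ) = Algebra.discr ℚ fun i => (v i : K) := by
  rw [Algebra.discr_def, Algebra.discr_def,
    ← eq_intCast (Int.castRingHom ℚ) (Algebra.traceMatrix ℤ v).det, RingHom.map_det]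
  congr 1
  ext i j
  simp only [RingHom.mapMatrix_apply, Matrix.map_apply, Algebra.traceMatrix_apply,
    Algebra.traceForm_apply, Int.coe_castRingHom, Algebra.coe_trace_int]
  push_cast
  rfl

/-- If a nonzero ideal `Q` satisfies `u Q ⊆ (v)` and `u / v` has pairwise distinct conjugates, all of
absolute value at most `A`, then the discriminant is bounded in terms of `A` and the norm of `Q`. -/
lemma discr_le_of_mul_le {K : Type*} [Field K] [NumberField K] {u v : 𝓞 K} {Q : Ideal (𝓞 K)} {A : ℝ}
    (hv : v ≠ 0) (hQ : Q ≠ ⊥) (hle : Ideal.span {u} * Q ≤ Ideal.span {v}) (hA1 : 1 ≤ A)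
    (hA : ∀ φ : K →+* ℂ, ‖φ u‖ ≤ A * ‖φ v‖)
    (hinj : ∀ φ ψ : K →+* ℂ, φ u * ψ v = ψ u * φ v → φ = ψ) :
    (DK K : ℝ) ≤ (Ideal.absNorm Q : ℝ) ^ (2 * (Module.finrank ℚ K - 1)) *
      (2 * A) ^ (2 * Module.finrank ℚ K ^ 2) := by
  classical
  set d := Module.finrank ℚ K with hd
  have hv' : (v : K) ≠ 0 := RingOfIntegers.coe_ne_zero_iff.mpr hv
  let G : Ideal (𝓞 K) := Ideal.span {u, v}
  have hG0 : G ≠ ⊥ := by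
    intro h
    have : v ∈ G := Ideal.subset_span (by simp)
    rw [h] at this
    exact hv this
  have hGQ : G * Q ≤ Ideal.span {v} := by
    rw [show G = Ideal.span {u} ⊔ Ideal.span {v} by rw [← Ideal.span_union]; rfl, Ideal.sup_mul]
    exact sup_le hle Ideal.mul_le_left
  let b := Module.finBasisOfFinrankEq ℤ (𝓞 K) ((RingOfIntegers.rank K).trans hd.symm)
  let x : Fin d → 𝓞 K := fun k => u ^ (k : ℕ) * v ^ (d - 1 - k)
  have hx : ∀ k, x k ∈ G ^ (d - 1) := by
    intro k
    have : d - 1 = k + (d - 1 - k) := by omega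
    rw [this, pow_add]
    refine Ideal.mul_mem_mul (Ideal.pow_mem_pow (Ideal.subset_span (by simp)) _) ?_
    exact Ideal.pow_mem_pow (Ideal.subset_span (by simp)) _
  have hdvd := absNorm_dvd_natAbs_det b (pow_ne_zero (d - 1) hG0) hx
  have hdisc : Algebra.discr ℤ x = b.det x ^ 2 * discr K := by
    conv_lhs => rw [← b.toMatrix_map_vecMul x, Algebra.discr_of_matrix_vecMul, discr_eq_discr K b]
    rfl
  let e : Fin d ≃ (K →ₐ[ℚ] ℂ) := (Fintype.equivFinOfCardEq (AlgHom.card ℚ K ℂ)).symm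
  let α : Fin d → ℂ := fun j => e j u / e j v
  have hvj : ∀ j, e j v ≠ 0 := fun j => (_root_.map_ne_zero (e j)).mpr hv'
  have hM : Algebra.embeddingsMatrixReindex ℚ ℂ (fun i => (x i : K)) e =
      Matrix.of fun i j => (e j v) ^ (d - 1) * (Matrix.vandermonde α).transpose i j := by
    ext i j
    have h1 : Algebra.embeddingsMatrixReindex ℚ ℂ (fun i => (x i : K)) e i j = e j (x i) := rfl
    have h2 : d - 1 = (d - 1 - i) + i := by omega
    rw [h1, Matrix.of_apply, Matrix.transpose_apply, Matrix.vandermonde_apply, div_pow]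
    simp only [x]
    push_cast
    rw [map_mul, map_pow, map_pow]
    nth_rewrite 2 [h2]
    rw [pow_add]
    field_simp [hvj j]
  have hdet : ((Algebra.discr ℤ x : ℤ) : ℂ) =
      ((∏ j, (e j v) ^ (d - 1)) * (Matrix.vandermonde α).det) ^ 2 := by
    have h := Algebra.discr_eq_det_embeddingsMatrixReindex_pow_two ℚ ℂ (fun i => (x i : K)) e
    rw [← coe_discr_int, hM, Matrix.det_mul_row, Matrix.det_transpose] at h
    simpa using h
  have hαinj : Function.Injective α := by
    intro i j hij
    simp only [α] at hij
    rw [div_eq_div_iff (hvj i) (hvj j)] at hij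
    have := hinj (e i).toRingHom (e j).toRingHom hij
    refine e.injective (AlgHom.ext fun z => ?_)
    exact congrArg (fun f : K →+* ℂ => f z) this
  have hvdm : (Matrix.vandermonde α).det ≠ 0 := Matrix.det_vandermonde_ne_zero_iff.mpr hαinj
  have hα : ∀ j, ‖α j‖ ≤ A := fun j => by
    rw [norm_div, div_le_iff₀ (norm_pos_iff.mpr (hvj j))]
    exact hA (e j).toRingHom
  have hvdm_le : ‖(Matrix.vandermonde α).det‖ ≤ (2 * A) ^ (d ^ 2) := by
    rw [Matrix.det_vandermonde, norm_prod]
    calc ∏ i, ‖∏ j ∈ Finset.Ioi i, (α j - α i)‖ ≤ ∏ i : Fin d, (2 * A) ^ d := by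
          refine Finset.prod_le_prod (fun _ _ => norm_nonneg _) fun i _ => ?_
          rw [norm_prod]
          calc ∏ j ∈ Finset.Ioi i, ‖α j - α i‖ ≤ ∏ j ∈ Finset.Ioi i, (2 * A) := by
                refine Finset.prod_le_prod (fun _ _ => norm_nonneg _) fun j _ => ?_
                linarith [norm_sub_le (α j) (α i), hα i, hα j]
            _ = (2 * A) ^ (Finset.Ioi i).card := Finset.prod_const _
            _ ≤ (2 * A) ^ d := pow_le_pow_right₀ (by linarith)
                ((Finset.card_le_univ _).trans (by simp))
      _ = (2 * A) ^ (d ^ 2) := by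
          rw [Finset.prod_const, Finset.card_univ, Fintype.card_fin, ← pow_mul, sq]
  have hNv : ‖∏ j, (e j v : ℂ)‖ = (Ideal.absNorm (Ideal.span {v}) : ℝ) := by
    rw [e.prod_comp (fun σ : K →ₐ[ℚ] ℂ => σ v), ← Algebra.norm_eq_prod_embeddings,
      ← Algebra.coe_norm_int, Ideal.absNorm_span_singleton, Nat.cast_natAbs]
    simp
  set NG : ℝ := (Ideal.absNorm G : ℝ) with hNG
  have hNG0 : 0 < NG := by
    rw [hNG]
    exact_mod_cast Nat.pos_of_ne_zero (by rwa [Ne, Ideal.absNorm_eq_zero_iff])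
  set NQ : ℝ := (Ideal.absNorm Q : ℝ) with hNQ
  have hNvle : (Ideal.absNorm (Ideal.span {v}) : ℝ) ≤ NG * NQ := by
    have h := Ideal.absNorm_dvd_absNorm_of_le hGQ
    rw [map_mul] at h
    have := Nat.le_of_dvd (Nat.pos_of_ne_zero (by
      simp only [ne_eq, mul_eq_zero, Ideal.absNorm_eq_zero_iff, not_or]
      exact ⟨hG0, hQ⟩)) h
    rw [hNG, hNQ]
    exact_mod_cast this
  have hup : |((Algebra.discr ℤ x : ℤ) : ℝ)| ≤
      ((NG * NQ) ^ (d - 1) * (2 * A) ^ (d ^ 2)) ^ 2 := by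
    have h : ‖((Algebra.discr ℤ x : ℤ) : ℂ)‖ = |((Algebra.discr ℤ x : ℤ) : ℝ)| := by
      rw [Complex.norm_intCast]
    rw [← h, hdet, norm_pow, norm_mul, Finset.prod_pow, norm_pow, hNv]
    gcongr
  have hne : Algebra.discr ℤ x ≠ 0 := by
    intro h0
    rw [h0, Int.cast_zero, eq_comm, sq_eq_zero_iff, mul_eq_zero] at hdet
    rcases hdet with h | h
    · obtain ⟨j, -, hj⟩ := Finset.prod_eq_zero_iff.mp h
      exact hvj j (eq_zero_of_pow_eq_zero hj)
    · exact hvdm h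
  have hdet0 : b.det x ≠ 0 := by
    intro h0
    rw [hdisc, h0] at hne
    simp at hne
  have hlow : NG ^ (d - 1) ≤ |(b.det x : ℝ)| := by
    have h := Nat.le_of_dvd (Int.natAbs_pos.mpr hdet0) hdvd
    rw [map_pow] at h
    have h' : ((Ideal.absNorm G ^ (d - 1) : ℕ) : ℝ) ≤ ((b.det x).natAbs : ℝ) := by exact_mod_cast h
    rw [Nat.cast_natAbs] at h'
    push_cast at h'
    exact h'
  have hDK : |((Algebra.discr ℤ x : ℤ) : ℝ)| = |(b.det x : ℝ)| ^ 2 * DK K := by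
    rw [hdisc, DK, Nat.cast_natAbs]
    push_cast
    rw [abs_mul, abs_pow]
  have hfin : (NG ^ (d - 1)) ^ 2 * DK K ≤
      (NG ^ (d - 1)) ^ 2 * (NQ ^ (2 * (d - 1)) * (2 * A) ^ (2 * d ^ 2)) := by
    calc (NG ^ (d - 1)) ^ 2 * DK K ≤ |(b.det x : ℝ)| ^ 2 * DK K := by gcongr
      _ ≤ ((NG * NQ) ^ (d - 1) * (2 * A) ^ (d ^ 2)) ^ 2 := hDK ▸ hup
      _ = _ := by rw [mul_pow, mul_pow, mul_pow, ← pow_mul NQ, ← pow_mul (2 * A)]; ring_nf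
  exact le_of_mul_le_mul_left hfin (by positivity)

lemma not_sq_dvd_of_not_dvd_discr {K : Type*} [Field K] [NumberField K] {P : Ideal (𝓞 K)} {p : ℕ}
    (hp : p.Prime) (hD : ¬ p ∣ DK K) (hP : P.IsPrime) (hpP : (p : 𝓞 K) ∈ P) :
    ¬ P ^ 2 ∣ Ideal.span {(p : 𝓞 K)} := by
  intro h
  have hmax : (Ideal.span {(p : ℤ)}).IsMaximal :=
    PrincipalIdealRing.isMaximal_of_irreducible (Nat.prime_iff_prime_int.mp hp).irreducible
  have h1 := pow_sub_one_dvd_differentIdeal ℤ (p := Ideal.span {(p : ℤ)}) P 2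
    (by rw [Ne, Ideal.span_singleton_eq_bot]; exact_mod_cast hp.ne_zero)
    (by rw [Ideal.map_span, Set.image_singleton]; simpa using h)
  rw [pow_one] at h1
  have h2 := Ideal.absNorm_dvd_absNorm_of_le (Ideal.le_of_dvd h1)
  rw [absNorm_differentIdeal K] at h2
  exact hD ((dvd_absNorm_of_natCast_mem hp hP hpP).trans h2)

lemma exists_prime_mem {K : Type*} [Field K] [NumberField K] {p : ℕ} (hp : p.Prime) :
    ∃ P : Ideal (𝓞 K), P.IsPrime ∧ P ≠ ⊥ ∧ (p : 𝓞 K) ∈ P := by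
  have hne : Ideal.span {(p : 𝓞 K)} ≠ ⊤ := by
    intro h
    have := Ideal.absNorm_span_natCast (S := 𝓞 K) p
    rw [h, Ideal.absNorm_top, RingOfIntegers.rank] at this
    have h2 := Nat.one_lt_pow (Module.finrank_pos (R := ℚ) (M := K)).ne' hp.one_lt
    omega
  obtain ⟨P, hP, hle⟩ := Ideal.exists_le_maximal _ hne
  have hpP : (p : 𝓞 K) ∈ P := hle (Ideal.mem_span_singleton_self _)
  refine ⟨P, hP.isPrime, ?_, hpP⟩
  rintro rfl
  exact hp.ne_zero (by exact_mod_cast (Ideal.mem_bot.mp hpP))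

/-- If `p` is unramified in `K` and `θ ^ d = a`, then the exponent of `p` in `a` is a multiple
of `d`. -/
lemma dvd_of_pow_eq {K : Type*} [Field K] [NumberField K] {p d n m : ℕ} (hp : p.Prime)
    (hD : ¬ p ∣ DK K) {θ : 𝓞 K} (hm : ¬ p ∣ m) (hθ : θ ^ d = (p : 𝓞 K) ^ n * m) : d ∣ n := by
  obtain ⟨P, hP, hP0, hpP⟩ := exists_prime_mem (K := K) hp
  have hPp : Prime P := (Ideal.prime_iff_isPrime hP0).mpr hP
  have hm0 : m ≠ 0 := fun h => hm (h ▸ dvd_zero p)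
  have hp0 : (p : 𝓞 K) ≠ 0 := by exact_mod_cast hp.ne_zero
  have hd : d ≠ 0 ∨ d = 0 := (eq_or_ne d 0).symm
  rcases hd with hd | rfl
  swap
  · rcases Nat.eq_zero_or_pos n with rfl | hn
    · exact dvd_rfl
    · exfalso
      rw [pow_zero] at hθ
      refine hP.ne_top ((Ideal.eq_top_iff_one P).mpr ?_)
      rw [hθ]
      exact P.mul_mem_right _ (P.pow_mem_of_mem hpP n hn)
  have hmP : (m : 𝓞 K) ∉ P := by
    intro h
    have hc : IsCoprime (p : ℤ) (m : ℤ) :=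
      Nat.isCoprime_iff_coprime.mpr ((Nat.Prime.coprime_iff_not_dvd hp).mpr hm)
    obtain ⟨x, y, hxy⟩ := hc
    refine hP.ne_top ((Ideal.eq_top_iff_one P).mpr ?_)
    have : (1 : 𝓞 K) = x * p + y * m := by exact_mod_cast hxy.symm
    rw [this]
    exact P.add_mem (P.mul_mem_left _ hpP) (P.mul_mem_left _ h)
  have hθ0 : θ ≠ 0 := by
    rintro rfl
    rw [zero_pow hd] at hθ
    exact mul_ne_zero (pow_ne_zero n hp0) (by exact_mod_cast hm0) hθ.symm
  have hspan : Ideal.span {θ} ^ d = Ideal.span {(p : 𝓞 K)} ^ n * Ideal.span {(m : 𝓞 K)} := by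
    rw [Ideal.span_singleton_pow, Ideal.span_singleton_pow, Ideal.span_singleton_mul_span_singleton,
      hθ]
  have he := congrArg (emultiplicity P) hspan
  have hone : emultiplicity P (Ideal.span {(p : 𝓞 K)}) = 1 := by
    have h1 : emultiplicity P (Ideal.span {(p : 𝓞 K)}) = ((1 : ℕ) : ℕ∞) := by
      rw [emultiplicity_eq_coe]
      exact ⟨by rw [pow_one]; exact Ideal.dvd_span_singleton.mpr hpP,
        not_sq_dvd_of_not_dvd_discr hp hD hP hpP⟩
    simpa using h1
  have hzero : emultiplicity P (Ideal.span {(m : 𝓞 K)}) = 0 := by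
    rw [emultiplicity_eq_zero, Ideal.dvd_span_singleton]
    exact hmP
  have hfin : FiniteMultiplicity P (Ideal.span {θ}) :=
    FiniteMultiplicity.of_not_isUnit hPp.not_isUnit (by simpa using hθ0)
  rw [emultiplicity_mul hPp, emultiplicity_pow hPp, emultiplicity_pow hPp, hone, hzero,
    hfin.emultiplicity_eq_multiplicity, mul_one, add_zero] at he
  exact ⟨_, by exact_mod_cast he.symm⟩

/-- At an unramified prime the radical can be normalised to have unit radicand. -/
lemma exists_pow_eq_of_not_dvd_discr {K : Type*} [Field K] [NumberField K] {p d a : ℕ}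
    (hp : p.Prime) (hD : ¬ p ∣ DK K) (ha : a ≠ 0) (hd : d ≠ 0) {θ : K} (hθ : θ ^ d = a)
    (hgen : IntermediateField.adjoin ℚ {θ} = ⊤) :
    ∃ (τ : 𝓞 K) (b : ℕ), ¬ p ∣ b ∧ τ ^ d = b ∧ IntermediateField.adjoin ℚ {(τ : K)} = ⊤ := by
  obtain ⟨n, m, hm, rfl⟩ := Nat.exists_eq_pow_mul_and_not_dvd ha p hp.ne_one
  have h_int : IsIntegral ℤ θ := by
    refine IsIntegral.of_pow (Nat.pos_of_ne_zero hd) ?_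
    rw [hθ]
    exact_mod_cast isIntegral_algebraMap (R := ℤ) (A := K) (x := ((p ^ n * m : ℕ) : ℤ))
  obtain ⟨k, rfl⟩ : d ∣ n := dvd_of_pow_eq (K := K) (θ := ⟨θ, h_int⟩) hp hD hm (by
    apply RingOfIntegers.ext
    push_cast at hθ ⊢
    exact hθ)
  have hp0 : (p : K) ≠ 0 := by exact_mod_cast hp.ne_zero
  have hτ : (θ / (p : K) ^ k) ^ d = m := by
    rw [div_pow, hθ, ← pow_mul]
    push_cast
    rw [mul_comm k d]
    field_simp
  have h_int' : IsIntegral ℤ (θ / (p : K) ^ k) := by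
    refine IsIntegral.of_pow (Nat.pos_of_ne_zero hd) ?_
    rw [hτ]
    exact_mod_cast isIntegral_algebraMap (R := ℤ) (A := K) (x := (m : ℤ))
  refine ⟨⟨_, h_int'⟩, m, hm, RingOfIntegers.ext (by push_cast; exact hτ), ?_⟩
  rw [eq_top_iff, ← hgen, IntermediateField.adjoin_simple_le_iff]
  have h1 : θ / (p : K) ^ k ∈ IntermediateField.adjoin ℚ {θ / (p : K) ^ k} :=
    IntermediateField.mem_adjoin_simple_self ℚ _
  have h2 : θ = θ / (p : K) ^ k * (p : K) ^ k := by field_simp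
  have h3 := mul_mem h1 (pow_mem (natCast_mem _ p) k)
  rwa [← h2] at h3

lemma algebraAdjoin_eq_top {K : Type*} [Field K] [NumberField K] {τ : K}
    (hgen : IntermediateField.adjoin ℚ {τ} = ⊤) : Algebra.adjoin ℚ {τ} = ⊤ := by
  rw [← IntermediateField.adjoin_simple_toSubalgebra_of_isAlgebraic
    (Algebra.IsIntegral.isIntegral τ).isAlgebraic, hgen]
  rfl

lemma norm_intCast_sub {K : Type*} [Field K] [NumberField K] {d b : ℕ} {τ : 𝓞 K}
    (hd : Module.finrank ℚ K = d) (hτ : τ ^ d = b)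
    (hgen : IntermediateField.adjoin ℚ {(τ : K)} = ⊤) (r : ℤ) :
    Algebra.norm ℤ ((r : 𝓞 K) - τ) = r ^ d - b := by
  have hd0 : d ≠ 0 := hd ▸ (Module.finrank_pos (R := ℚ) (M := K)).ne'
  have h_int : IsIntegral ℚ (τ : K) := Algebra.IsIntegral.isIntegral _
  have hmin : minpoly ℚ (τ : K) = X ^ d - C (b : ℚ) := by
    symm
    have hdvd : minpoly ℚ (τ : K) ∣ X ^ d - C (b : ℚ) := by
      apply minpoly.dvd
      simp only [map_sub, map_pow, aeval_X, aeval_C]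
      have h := congrArg (fun z : 𝓞 K => (z : K)) hτ
      push_cast at h
      rw [h]
      simp
    refine (Polynomial.eq_of_monic_of_dvd_of_natDegree_le (minpoly.monic h_int)
      (monic_X_pow_sub_C _ hd0) hdvd ?_)
    rw [natDegree_X_pow_sub_C, (Field.primitive_element_iff_minpoly_natDegree_eq ℚ _).mp hgen, hd]
  have htop := algebraAdjoin_eq_top hgen
  let pb := PowerBasis.ofAdjoinEqTop h_int htop
  have hpb : pb.gen = (τ : K) := PowerBasis.ofAdjoinEqTop_gen h_int htop
  have key : Algebra.norm ℚ ((r : K) - τ) = (r : ℚ) ^ d - b := by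
    have h1 : (r : K) = algebraMap ℚ K (r : ℚ) := by simp
    rw [Algebra.norm_eq_matrix_det pb.basis, map_sub, h1, AlgHom.commutes, ← hpb]
    change ((Matrix.scalar _) (r : ℚ) - _).det = _
    rw [← Matrix.eval_charpoly, charpoly_leftMulMatrix, hpb, hmin]
    simp
  have h : ((Algebra.norm ℤ ((r : 𝓞 K) - τ) : ℤ) : ℚ) = Algebra.norm ℚ ((r : K) - τ) := by
    rw [Algebra.coe_norm_int]
    congr 1
  rw [key] at h
  exact_mod_cast h

lemma exists_sq_not_dvd_pow_sub {p d b : ℕ} (hp : p.Prime) (hcop : (p - 1).Coprime d)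
    (hpd : ¬ p ∣ d) (hb : ¬ p ∣ b) :
    ∃ r : ℤ, ¬ (p : ℤ) ∣ r ∧ (p : ℤ) ∣ r ^ d - b ∧ ¬ (p : ℤ) ^ 2 ∣ r ^ d - b := by
  have : Fact p.Prime := ⟨hp⟩
  have hpi : Prime (p : ℤ) := Nat.prime_iff_prime_int.mp hp
  have hd0 : d ≠ 0 := fun h => hpd (h ▸ dvd_zero p)
  have hc : (Nat.card (ZMod p)ˣ).Coprime d := by
    rwa [Nat.card_eq_fintype_card, ZMod.card_units_eq_totient, Nat.totient_prime hp]
  obtain ⟨x, hx⟩ := (powCoprime hc).surjective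
    (ZMod.unitOfCoprime b ((Nat.Prime.coprime_iff_not_dvd hp).mpr hb).symm)
  have hx' : ((x : ZMod p)) ^ d = b := by
    have := congrArg (Units.val) hx
    simpa using this
  obtain ⟨s, hs⟩ : ∃ s : ℤ, (s : ZMod p) = x := ZMod.intCast_surjective _
  have hsb : (p : ℤ) ∣ s ^ d - b := by
    rw [← ZMod.intCast_eq_intCast_iff_dvd_sub, eq_comm]
    push_cast
    rw [hs, hx']
  have hps : ¬ (p : ℤ) ∣ s := by
    intro h
    have h1 : (p : ℤ) ∣ b := by
      have := dvd_sub (dvd_pow h hd0) hsb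
      simpa using this
    exact hb (by exact_mod_cast h1)
  by_cases h2 : (p : ℤ) ^ 2 ∣ s ^ d - b
  swap
  · exact ⟨s, hps, hsb, h2⟩
  obtain ⟨k, hk⟩ := Polynomial.powAddExpansion s (p : ℤ) d
  have hexp : (s + p) ^ d - b = (s ^ d - b) + d * s ^ (d - 1) * p + k * (p : ℤ) ^ 2 := by
    rw [hk]; ring
  refine ⟨s + p, ?_, ?_, ?_⟩
  · intro h
    exact hps (by simpa using dvd_sub h (dvd_refl (p : ℤ)))
  · rw [hexp]
    exact dvd_add (dvd_add hsb (dvd_mul_left _ _)) (dvd_mul_of_dvd_right (dvd_pow_self _ two_ne_zero) _)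
  · rw [hexp]
    intro h
    have h3 : (p : ℤ) ^ 2 ∣ d * s ^ (d - 1) * p := by
      have := dvd_sub (dvd_sub h h2) (dvd_mul_left ((p : ℤ) ^ 2) k)
      ring_nf at this ⊢
      exact this
    rw [sq] at h3
    have h4 := (mul_dvd_mul_iff_right hpi.ne_zero).mp h3
    rcases hpi.dvd_or_dvd h4 with h5 | h5
    · exact hpd (by exact_mod_cast h5)
    · exact hps (hpi.dvd_of_dvd_pow h5)

/-- Primes of degree one in a pure field. -/
lemma exists_prime_ideal_absNorm_eq {K : Type*} [Field K] [NumberField K] {p d a : ℕ}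
    (hp : p.Prime) (hD : ¬ p ∣ DK K) (hcop : (p - 1).Coprime d) (hpd : ¬ p ∣ d) (ha : a ≠ 0)
    (hd : Module.finrank ℚ K = d) {θ : K} (hθ : θ ^ d = a)
    (hgen : IntermediateField.adjoin ℚ {θ} = ⊤) :
    ∃ (P : Ideal (𝓞 K)) (τ : 𝓞 K) (b : ℕ) (r : ℤ), P.IsPrime ∧ Ideal.absNorm P = p ∧
      (r : 𝓞 K) - τ ∈ P ∧ ¬ (p : ℤ) ∣ r ∧ τ ^ d = b ∧
      IntermediateField.adjoin ℚ {(τ : K)} = ⊤ := by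
  have hd0 : d ≠ 0 := fun h => hpd (h ▸ dvd_zero p)
  obtain ⟨τ, b, hb, hτ, hτgen⟩ := exists_pow_eq_of_not_dvd_discr hp hD ha hd0 hθ hgen
  obtain ⟨r, hr, hrb, hrb2⟩ := exists_sq_not_dvd_pow_sub hp hcop hpd hb
  have hnorm : (Ideal.absNorm (Ideal.span {(r : 𝓞 K) - τ})) = (r ^ d - (b : ℤ)).natAbs := by
    rw [Ideal.absNorm_span_singleton, norm_intCast_sub hd hτ hτgen]
  have hne : Ideal.span {(r : 𝓞 K) - τ} ≠ ⊥ := by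
    intro h
    rw [h, Ideal.absNorm_bot] at hnorm
    rw [Int.natAbs_eq_zero.mp hnorm.symm] at hrb2
    exact hrb2 (dvd_zero _)
  have hdvd : p ∣ ((UniqueFactorizationMonoid.normalizedFactors
      (Ideal.span {(r : 𝓞 K) - τ})).map Ideal.absNorm).prod := by
    rw [← map_multiset_prod, Ideal.prod_normalizedFactors_eq_self hne, hnorm]
    exact Int.natCast_dvd.mp hrb
  obtain ⟨P, hP, hpP⟩ := (Nat.prime_iff.mp hp).exists_mem_multiset_map_dvd hdvd
  have hPp := UniqueFactorizationMonoid.prime_of_normalized_factor P hP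
  have hPprime : P.IsPrime := Ideal.isPrime_of_prime hPp
  have hmax := hPprime.isMaximal hPp.ne_zero
  have hdvdP := UniqueFactorizationMonoid.dvd_of_mem_normalizedFactors hP
  refine ⟨P, τ, b, r, hPprime, ?_, Ideal.dvd_span_singleton.mp hdvdP, hr, hτ, hτgen⟩
  obtain ⟨q, k, hk, -, hq, hqk⟩ := Ideal.exists_prime_and_absNorm_eq_pow P
  have hpq : p = q := by
    rw [hqk] at hpP
    exact (Nat.prime_dvd_prime_iff_eq hp hq).mp (hp.dvd_of_dvd_pow hpP)
  subst hpq
  have h1 : p ^ k ∣ (r ^ d - (b : ℤ)).natAbs := by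
    rw [← hqk, ← hnorm]
    exact Ideal.absNorm_dvd_absNorm_of_le (Ideal.le_of_dvd hdvdP)
  have hk1 : k = 1 := by
    by_contra hk1
    have h2 : p ^ 2 ∣ (r ^ d - (b : ℤ)).natAbs := (pow_dvd_pow p (by omega)).trans h1
    exact hrb2 (by exact_mod_cast Int.natCast_dvd.mpr h2)
  rw [hqk, hk1, pow_one]

/-- The map on rings of integers induced by a complex embedding. -/
noncomputable def integersEmbedding {K : Type*} [Field K] [NumberField K] (φ : K →+* ℂ) :
    𝓞 K →+* integralClosure ℤ ℂ :=
  (φ.comp (algebraMap (𝓞 K) K)).codRestrict (integralClosure ℤ ℂ) fun x =>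
    map_isIntegral_int φ (RingOfIntegers.isIntegral_coe x)

lemma exists_prime_comap_eq {K : Type*} [Field K] [NumberField K] (φ : K →+* ℂ)
    (P : Ideal (𝓞 K)) (hP : P.IsPrime) :
    ∃ R : Ideal (integralClosure ℤ ℂ), R.IsPrime ∧ R.comap (integersEmbedding φ) = P := by
  have hinj : Function.Injective (integersEmbedding φ) := fun x y h =>
    RingOfIntegers.ext (φ.injective (congrArg (fun z : integralClosure ℤ ℂ => (z : ℂ)) h))
  let _ := (integersEmbedding φ).toAlgebra
  have : Algebra.IsIntegral (𝓞 K) (integralClosure ℤ ℂ) :=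
    Algebra.IsIntegral.tower_top (R := ℤ)
  obtain ⟨R, -, hR, hRP⟩ := Ideal.exists_ideal_over_prime_of_isIntegral P
    (⊥ : Ideal (integralClosure ℤ ℂ)) (by
      intro x hx
      have h0 : integersEmbedding φ x = 0 := hx
      rw [(map_eq_zero_iff _ hinj).mp h0]
      exact P.zero_mem)
  exact ⟨R, hR, hRP⟩

/-- A difference of two distinct `d`-th roots of the same number is not divisible by primes
not dividing `d`. -/
lemma dvd_of_pow_eq_pow_of_sub_mem {A : Type*} [CommRing A] [IsDomain A] {R : Ideal A}
    (hR : R.IsPrime) {x y : A} {d p : ℕ} {r : ℤ} (hp : p.Prime) (hpR : (p : A) ∈ R) (hxy : x ≠ y)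
    (hpow : x ^ d = y ^ d) (hx : (r : A) - x ∈ R) (hy : (r : A) - y ∈ R) :
    p ∣ d ∨ (p : ℤ) ∣ r := by
  have h0 : ∑ i ∈ Finset.range d, x ^ i * y ^ (d - 1 - i) = 0 := by
    have h1 := (Commute.all x y).geom_sum₂_mul d
    rw [hpow, sub_self] at h1
    exact (mul_eq_zero.mp h1).resolve_right (sub_ne_zero.mpr hxy)
  have hmk : ∀ z : A, (r : A) - z ∈ R → Ideal.Quotient.mk R z = r := fun z hz => by
    have := (Ideal.Quotient.mk_eq_mk_iff_sub_mem _ _).mpr hz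
    rw [← this]; simp
  have h2 := congrArg (Ideal.Quotient.mk R) h0
  simp only [map_sum, map_mul, map_pow, hmk x hx, hmk y hy, map_zero] at h2
  rw [Finset.sum_congr rfl (g := fun _ => (r : A ⧸ R) ^ (d - 1)) (fun i hi => by
    rw [← pow_add]; congr 1; have := Finset.mem_range.mp hi; omega)] at h2
  rw [Finset.sum_const, Finset.card_range, nsmul_eq_mul] at h2
  have h3 : ((d * r ^ (d - 1) : ℤ) : A) ∈ R := by
    rw [← Ideal.Quotient.eq_zero_iff_mem]
    push_cast
    simpa using h2
  have hpi : Prime (p : ℤ) := Nat.prime_iff_prime_int.mp hp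
  have hcop : (p : ℤ) ∣ d * r ^ (d - 1) := by
    by_contra hc
    obtain ⟨s, t, hst⟩ := hpi.irreducible.coprime_iff_not_dvd.mpr hc
    refine hR.ne_top ((Ideal.eq_top_iff_one R).mpr ?_)
    have h4 : (1 : A) = s * p + t * ((d * r ^ (d - 1) : ℤ) : A) := by 
      have := congrArg (fun z : ℤ => (z : A)) hst
      push_cast at this ⊢
      exact this.symm
    rw [h4]
    exact R.add_mem (R.mul_mem_left _ hpR) (R.mul_mem_left _ h3)
  rcases hpi.dvd_or_dvd hcop with h | h
  · exact Or.inl (by exact_mod_cast h)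
  · exact Or.inr (hpi.dvd_of_dvd_pow h)

lemma eq_top_of_natCast_mem {A : Type*} [CommRing A] {R : Ideal A} {p q : ℕ} (hpq : p.Coprime q)
    (hp : (p : A) ∈ R) (hq : (q : A) ∈ R) : R = ⊤ := by
  obtain ⟨s, t, hst⟩ := Nat.isCoprime_iff_coprime.mpr hpq
  rw [Ideal.eq_top_iff_one]
  have h4 : (1 : A) = s * p + t * q := by 
    have := congrArg (fun z : ℤ => (z : A)) hst
    push_cast at this
    exact this.symm
  rw [h4]
  exact R.add_mem (R.mul_mem_left _ hp) (R.mul_mem_left _ hq)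

lemma ringHom_ext_of_adjoin_eq_top {K : Type*} [Field K] [NumberField K] {τ : K}
    (hgen : IntermediateField.adjoin ℚ {τ} = ⊤) {φ ψ : K →+* ℂ} (h : φ τ = ψ τ) : φ = ψ := by
  have := AlgHom.ext_of_adjoin_eq_top (algebraAdjoin_eq_top hgen) (φ₁ := φ.toRatAlgHom) (φ₂ := ψ.toRatAlgHom)
    (fun x hx => by rw [Set.mem_singleton_iff.mp hx]; exact h)
  ext x
  exact DFunLike.congr_fun this x

/-- Conjugate elements agreeing under two embeddings cannot lie in a single prime above `p`. -/
lemma ringHom_eq_of_unique_prime {K : Type*} [Field K] [NumberField K] {P : Ideal (𝓞 K)}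
    {p d b : ℕ} (hp : p.Prime) (hP : P.IsPrime) (hpP : (p : 𝓞 K) ∈ P) {τ β : 𝓞 K} {r : ℤ}
    (hr : (r : 𝓞 K) - τ ∈ P) (hpr : ¬ (p : ℤ) ∣ r) (hpd : ¬ p ∣ d) (hτ : τ ^ d = b)
    (hgen : IntermediateField.adjoin ℚ {(τ : K)} = ⊤) (hβP : β ∈ P)
    (huniq : ∀ R : Ideal (𝓞 K), R.IsPrime → (p : 𝓞 K) ∈ R → β ∈ R → P = R)
    {φ ψ : K →+* ℂ} (hβ : φ β = ψ β) : φ = ψ := by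
  by_contra hne
  have hττ : φ τ ≠ ψ τ := fun h => hne (ringHom_ext_of_adjoin_eq_top hgen h)
  obtain ⟨R, hR, hRP⟩ := exists_prime_comap_eq φ P hP
  have hpR : (p : integralClosure ℤ ℂ) ∈ R := by
    rw [← hRP, Ideal.mem_comap, map_natCast] at hpP
    exact hpP
  have hββ : integersEmbedding ψ β = integersEmbedding φ β := Subtype.ext hβ.symm
  have hcomap : P = R.comap (integersEmbedding ψ) := by
    refine huniq _ (Ideal.comap_isPrime _ _) ?_ ?_
    · rw [Ideal.mem_comap, map_natCast]
      exact hpR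
    · rw [Ideal.mem_comap, hββ, ← Ideal.mem_comap, hRP]
      exact hβP
  have h4 : (r : integralClosure ℤ ℂ) - integersEmbedding φ τ ∈ R := by
    rw [← map_intCast (integersEmbedding φ), ← map_sub, ← Ideal.mem_comap, hRP]
    exact hr
  have h5 : (r : integralClosure ℤ ℂ) - integersEmbedding ψ τ ∈ R := by
    rw [← map_intCast (integersEmbedding ψ), ← map_sub, ← Ideal.mem_comap, ← hcomap]
    exact hr
  have hpow : integersEmbedding φ τ ^ d = integersEmbedding ψ τ ^ d := by
    rw [← map_pow, ← map_pow, hτ, map_natCast, map_natCast]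
  rcases dvd_of_pow_eq_pow_of_sub_mem hR hp hpR
    (fun h => hττ (congrArg (fun z : integralClosure ℤ ℂ => (z : ℂ)) h)) hpow h4 h5 with h6 | h6
  · exact hpd h6
  · exact hpr h6

/-- If `(u / v) Q ^ ℓ = P ^ ℓ` for suitable primes `P`, `Q` of a pure field, then `u / v`
has pairwise distinct conjugates. -/
lemma ringHom_eq_of_mul_eq {K : Type*} [Field K] [NumberField K] {P Q : Ideal (𝓞 K)}
    {p q d b ℓ : ℕ} (hp : p.Prime) (hq : q.Prime) (hpq : p ≠ q) (hP : P.IsPrime)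
    (hNP : Ideal.absNorm P = p) (hNQ : Ideal.absNorm Q = q) {τ : 𝓞 K} {r : ℤ}
    (hr : (r : 𝓞 K) - τ ∈ P) (hpr : ¬ (p : ℤ) ∣ r) (hpd : ¬ p ∣ d) (hτ : τ ^ d = b)
    (hgen : IntermediateField.adjoin ℚ {(τ : K)} = ⊤) (hℓ : 0 < ℓ) {u v : 𝓞 K}
    (hv : v ≠ 0) (h : Ideal.span {u} * Q ^ ℓ = Ideal.span {v} * P ^ ℓ)
    {φ ψ : K →+* ℂ} (hφψ : φ u * ψ v = ψ u * φ v) : φ = ψ := by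
  have hpP : (p : 𝓞 K) ∈ P := hNP ▸ Ideal.absNorm_mem P
  have hqQ : (q : 𝓞 K) ∈ Q := hNQ ▸ Ideal.absNorm_mem Q
  have hP0 : P ≠ ⊥ := by
    rintro rfl
    exact hp.ne_zero (by simpa using hNP.symm)
  obtain ⟨M, hM⟩ := Ideal.dvd_span_singleton.mpr hqQ
  have hqM : (q : 𝓞 K) ∈ M := by
    rw [← Ideal.dvd_span_singleton, hM]
    exact dvd_mul_left _ _
  have h1 : Ideal.span {u * (q : 𝓞 K) ^ ℓ} = Ideal.span {v} * (P ^ ℓ * M ^ ℓ) := by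
    rw [← Ideal.span_singleton_mul_span_singleton, ← Ideal.span_singleton_pow, hM, mul_pow,
      ← mul_assoc, h, mul_assoc]
  obtain ⟨β, hβ⟩ : v ∣ u * (q : 𝓞 K) ^ ℓ := by
    rw [← Ideal.span_singleton_le_span_singleton, h1]
    exact Ideal.le_of_dvd (dvd_mul_right _ _)
  have hβspan : Ideal.span {β} = P ^ ℓ * M ^ ℓ := by
    rw [hβ, ← Ideal.span_singleton_mul_span_singleton] at h1
    exact mul_left_cancel₀ (by simpa using hv) h1
  have hβP : β ∈ P := by
    rw [← Ideal.dvd_span_singleton, hβspan]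
    exact (dvd_pow_self P hℓ.ne').mul_right _
  have huniq : ∀ R : Ideal (𝓞 K), R.IsPrime → (p : 𝓞 K) ∈ R → β ∈ R → P = R := by
    intro R hR hpR hβR
    have h2 : P ^ ℓ * M ^ ℓ ≤ R := by
      rwa [← hβspan, Ideal.span_singleton_le_iff_mem]
    rcases hR.mul_le.mp h2 with h3 | h3
    · exact (hP.isMaximal hP0).eq_of_le hR.ne_top (hR.le_of_pow_le h3)
    · exact absurd (eq_top_of_natCast_mem ((Nat.coprime_primes hp hq).mpr hpq) hpR
        (hR.le_of_pow_le h3 hqM)) hR.ne_top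
  have hφv : ∀ φ : K →+* ℂ, φ v ≠ 0 := fun φ => by
    rw [_root_.map_ne_zero]
    exact_mod_cast hv
  have hβ' : ∀ φ : K →+* ℂ, φ u * (q : ℂ) ^ ℓ = φ v * φ β := fun φ => by
    have h2 := congrArg (fun z : 𝓞 K => φ z) hβ
    simpa using h2
  have hββ : φ β = ψ β := by
    apply mul_left_cancel₀ (mul_ne_zero (hφv φ) (hφv ψ))
    linear_combination (-ψ v) * hβ' φ + φ v * hβ' ψ + (q : ℂ) ^ ℓ * hφψ
  exact ringHom_eq_of_unique_prime hp hP hpP hr hpr hpd hτ hgen hβP huniq hββ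

lemma card_torsion_mul_card_primes_le {K : Type*} [Field K] [NumberField K] {d a ℓ : ℕ}
    (hodd : Odd d) (hℓ : 0 < ℓ) (ha : a ≠ 0) (hd : Module.finrank ℚ K = d) {θ : K}
    (hθ : θ ^ d = a) (hgen : IntermediateField.adjoin ℚ {θ} = ⊤) {X Λ M : ℝ}
    (hX : X ^ (2 * ℓ * (d - 1)) * (2 * Real.exp ℓ) ^ (2 * d ^ 2) < DK K)
    (hΛ : 1 < Λ) (hD : 2 ^ d * √(DK K) < Λ ^ d)
    (hM : ∀ S : Finset (Ideal (𝓞 K)),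
      (∀ I ∈ S, I ≠ ⊥ ∧ (Ideal.absNorm I : ℝ) ≤ Λ ^ d) → (S.card : ℝ) ≤ M) {T : Finset ℕ}
    (hT : ∀ p ∈ T, p.Prime ∧ (p : ℝ) ≤ X ∧ (p : ZMod d) = 2 ∧ ¬ p ∣ DK K) :
    (Nat.card {c : ClassGroup (𝓞 K) // c ^ ℓ = 1} : ℝ) * T.card ≤
      M * ((d + 1) * Real.log Λ + 2) ^ d := by
  have h2unit : IsUnit (2 : ZMod d) := by
    have := (ZMod.isUnit_iff_coprime 2 d).mpr (Nat.coprime_two_left.mpr hodd)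
    exact_mod_cast this
  have hcop : ∀ p ∈ T, (p - 1).Coprime d ∧ ¬ p ∣ d := by
    intro p hp
    obtain ⟨hp1, -, hp2, -⟩ := hT p hp
    refine ⟨?_, ?_⟩
    · rw [← ZMod.isUnit_iff_coprime, Nat.cast_sub hp1.one_le, hp2]
      norm_num
    · rw [← Nat.Prime.coprime_iff_not_dvd hp1, ← ZMod.isUnit_iff_coprime, hp2]
      exact h2unit
  have hex : ∀ p, ∃ P : Ideal (𝓞 K), p ∈ T → P.IsPrime ∧ Ideal.absNorm P = p ∧
      ∃ (τ : 𝓞 K) (b : ℕ) (r : ℤ), (r : 𝓞 K) - τ ∈ P ∧ ¬ (p : ℤ) ∣ r ∧ τ ^ d = b ∧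
      IntermediateField.adjoin ℚ {(τ : K)} = ⊤ := by
    intro p
    by_cases hp : p ∈ T
    · obtain ⟨hp1, -, -, hp3⟩ := hT p hp
      obtain ⟨P, τ, b, r, h1, h2, h3⟩ := exists_prime_ideal_absNorm_eq hp1 hp3 (hcop p hp).1
        (hcop p hp).2 ha hd hθ hgen
      exact ⟨P, fun _ => ⟨h1, h2, τ, b, r, h3⟩⟩
    · exact ⟨⊥, fun h => absurd h hp⟩
  choose f hf using hex
  classical
  have hinj : Set.InjOn f T := fun p hp q hq h => by
    rw [← (hf p hp).2.1, ← (hf q hq).2.1, h]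
  subst hd
  have key := card_torsion_mul_card_le (K := K) hℓ (s := T.image f) ?_ ?_ hΛ hD hM
  · rwa [Finset.card_image_of_injOn hinj] at key
  · intro P hP
    obtain ⟨p, hp, rfl⟩ := Finset.mem_image.mp hP
    intro h
    have := (hf p hp).2.1
    rw [h, Ideal.absNorm_bot] at this
    exact (hT p hp).1.ne_zero this.symm
  · intro P hP Q hQ hPQ _ u v _ hv huv
    obtain ⟨p, hp, rfl⟩ := Finset.mem_image.mp hP
    obtain ⟨q, hq, rfl⟩ := Finset.mem_image.mp hQ
    have hpq : p ≠ q := fun h => hPQ (h ▸ rfl)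
    obtain ⟨h1, h2, τ, b, r, h3, h4, h5, h6⟩ := hf p hp
    obtain ⟨-, hq2, -⟩ := hf q hq
    by_contra! hw
    have hle : Ideal.span {u} * f q ^ ℓ ≤ Ideal.span {v} := by
      rw [huv]
      exact Ideal.le_of_dvd (dvd_mul_right _ _)
    have hQ0 : f q ^ ℓ ≠ ⊥ := by
      refine pow_ne_zero _ fun h => ?_
      rw [h] at hq2
      exact (hT q hq).1.ne_zero (by simpa using hq2.symm)
    have hdisc := discr_le_of_mul_le hv hQ0 hle (A := Real.exp ℓ)
      (Real.one_le_exp (Nat.cast_nonneg _))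
      (fun φ => by simpa using hw (InfinitePlace.mk φ))
      (fun φ ψ h => ringHom_eq_of_mul_eq (hT p hp).1 (hT q hq).1 hpq h1 h2 hq2 h3 h4
        (hcop p hp).2 h5 h6 hℓ hv huv h)
    refine absurd hX (not_lt.mpr (hdisc.trans ?_))
    gcongr
    rw [map_pow, hq2]
    push_cast
    rw [← pow_mul]
    calc (q : ℝ) ^ (ℓ * (2 * (Module.finrank ℚ K - 1))) =
        (q : ℝ) ^ (2 * ℓ * (Module.finrank ℚ K - 1)) := by congr 1; ring
      _ ≤ _ := by gcongr; exact (hT q hq).2.1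

lemma card_filter_dvd_le {n : ℕ} (hn : n ≠ 0) {T : Finset ℕ} (hT : ∀ p ∈ T, p.Prime) :
    ((T.filter (· ∣ n)).card : ℝ) ≤ Real.log n / Real.log 2 := by
  have h1 : 2 ^ (T.filter (· ∣ n)).card ≤ n := by
    calc 2 ^ (T.filter (· ∣ n)).card ≤ ∏ p ∈ T.filter (· ∣ n), p :=
          Finset.pow_card_le_prod _ _ _ fun p hp => (hT p (Finset.mem_filter.mp hp).1).two_le
      _ ≤ ∏ p ∈ n.primeFactors, p := by
          refine Finset.prod_le_prod_of_subset_of_one_le' (fun p hp => ?_) fun p hp _ =>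
            (Nat.prime_of_mem_primeFactors hp).one_le
          have hp := Finset.mem_filter.mp hp
          exact Nat.mem_primeFactors.mpr ⟨hT p hp.1, hp.2, hn⟩
      _ ≤ n := Nat.le_of_dvd (Nat.pos_of_ne_zero hn) (Nat.prod_primeFactors_dvd n)
  rw [le_div_iff₀ (Real.log_pos one_lt_two), ← Real.log_pow]
  exact Real.log_le_log (by positivity) (by exact_mod_cast h1)

open Filter in
/-- Growth of the number of admissible primes up to a small multiple of a power of `D`. -/
lemma eventually_card_primes_rpow_ge {d : ℕ} (hodd : Odd d) {κ δ η : ℝ} (hκ : 0 < κ) (hδ : 0 < δ)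
    (hη : 0 < η) (hη1 : η < 1) :
    ∃ c, 0 < c ∧ ∀ᶠ D : ℝ in atTop, ∀ n : ℕ, (n : ℝ) = D →
      c * D ^ (δ * (1 - η)) ≤ (((Finset.Icc 1 ⌊κ * D ^ δ⌋₊).filter fun p : ℕ =>
        (p.Prime ∧ (p : ZMod d) = 2) ∧ ¬ p ∣ n).card : ℝ) := by
  have : NeZero d := ⟨fun h => by simp [h] at hodd⟩
  have h2unit : IsUnit (2 : ZMod d) := by
    have := (ZMod.isUnit_iff_coprime 2 d).mpr (Nat.coprime_two_left.mpr hodd)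
    exact_mod_cast this
  obtain ⟨c, hc, hcX⟩ := eventually_card_primes_ge h2unit hη hη1
  have hlog2 := Real.log_pos one_lt_two
  have hδη : 0 < δ * (1 - η) := mul_pos hδ (by linarith)
  have hXtop : Tendsto (fun D : ℝ => κ * D ^ δ) atTop atTop :=
    (tendsto_rpow_atTop hδ).const_mul_atTop hκ
  set c' := c * κ ^ (1 - η) with hc'
  have hc'0 : 0 < c' := by positivity
  refine ⟨c' / 2, by positivity, ?_⟩
  filter_upwards [hXtop.eventually hcX, eventually_ge_atTop 1,
    eventually_mul_log_add_le_rpow (2 / (c' * Real.log 2)) 0 hδη] with D h1 hD1 h2 n hn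
  have hn0 : n ≠ 0 := by
    rintro rfl
    norm_num at hn
    linarith
  set T := (Finset.Icc 1 ⌊κ * D ^ δ⌋₊).filter fun p : ℕ => p.Prime ∧ (p : ZMod d) = 2 with hT
  have h3 := card_filter_dvd_le hn0 (T := T) (fun p hp => (Finset.mem_filter.mp hp).2.1)
  have h4 : ((T.filter (· ∣ n)).card : ℝ) + ((T.filter (fun p => ¬ p ∣ n)).card : ℝ) = T.card := by
    exact_mod_cast Finset.card_filter_add_card_filter_not (s := T) (· ∣ n)
  rw [← Finset.filter_filter, ← hT]
  have h5 : c * (κ * D ^ δ) ^ (1 - η) = c' * D ^ (δ * (1 - η)) := by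
    rw [Real.mul_rpow hκ.le (by positivity), ← Real.rpow_mul (by linarith), hc', mul_assoc]
  rw [h5] at h1
  have h6 : Real.log n / Real.log 2 ≤ c' / 2 * D ^ (δ * (1 - η)) := by
    rw [hn]
    calc Real.log D / Real.log 2 = c' / 2 * (2 / (c' * Real.log 2) * Real.log D + 0) := by
          field_simp
          ring
      _ ≤ _ := by gcongr
  linarith

/-- torsion bound for pure fields of odd degree `d` (inequality `ineq:SilHB`). -/
theorem torsion_pure_field (d ℓ : ℕ) (hd3 : 3 ≤ d) (hodd : Odd d) (hℓ : 0 < ℓ)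
    (ε : ℝ) (hε : 0 < ε) :
    ∃ C : ℝ, 0 < C ∧
      ∀ (K : Type) (_ : Field K) (_ : NumberField K) (a : ℕ) (θ : K),
        1 < a → Irreducible ((Polynomial.X : ℚ[X]) ^ d - Polynomial.C (a : ℚ)) →
        θ ^ d = (a : K) → IntermediateField.adjoin ℚ {θ} = ⊤ →
        Module.finrank ℚ K = d →
        (Nat.card {c : ClassGroup (𝓞 K) // c ^ ℓ = 1} : ℝ) ≤
          C * (DK K : ℝ) ^ ((1 : ℝ) / 2 - 1 / (2 * ((d : ℝ) - 1) * (ℓ : ℝ)) + ε) := by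
  have hd0 : d ≠ 0 := by omega
  have hd3' : (3 : ℝ) ≤ d := by exact_mod_cast hd3
  have hℓ' : (1 : ℝ) ≤ ℓ := by exact_mod_cast hℓ
  set δ : ℝ := 1 / (2 * ((d : ℝ) - 1) * ℓ) with hδ
  have hden : 1 ≤ ((d : ℝ) - 1) * ℓ := by nlinarith
  have hδ0 : 0 < δ := by rw [hδ]; apply one_div_pos.mpr; nlinarith
  have hδ1 : δ ≤ 1 / 2 := by
    rw [hδ]
    apply one_div_le_one_div_of_le two_pos
    linarith
  set η : ℝ := min (ε / 2) (1 / 2) with hη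
  have hη0 : 0 < η := by positivity
  have hη1 : η < 1 := (min_le_right _ _).trans_lt (by norm_num)
  have hηε : 2 * η ≤ ε := by linarith [min_le_left (ε / 2) (1 / 2 : ℝ)]
  set B : ℝ := (2 * Real.exp ℓ) ^ (2 * d ^ 2) with hB
  have hB1 : 1 ≤ B := one_le_pow₀ (by linarith [Real.one_le_exp (Nat.cast_nonneg (α := ℝ) ℓ)])
  set κ : ℝ := 1 / (2 * B) with hκ
  have hκ0 : 0 < κ := by positivity
  obtain ⟨C₁, hC₁, hA⟩ := exists_card_ideal_le d hη0
  obtain ⟨c, hc, hT⟩ := eventually_card_primes_rpow_ge hodd hκ0 hδ0 hη0 hη1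
  have hlog := eventually_mul_log_add_pow_le_rpow (((d : ℝ) + 1) * (1 / (2 * d)))
    (((d : ℝ) + 1) * Real.log 4 + 2) (by positivity)
    (by have := Real.log_nonneg (show (1 : ℝ) ≤ 4 by norm_num); positivity) hη0 hd0
  obtain ⟨D₀, hD₀⟩ := Filter.eventually_atTop.mp (hT.and hlog)
  set Y : ℝ := max D₀ 1 with hY
  have hY1 : 1 ≤ Y := le_max_right _ _
  set Λ : ℝ → ℝ := fun D => 4 * D ^ (1 / (2 * (d : ℝ))) with hΛ
  have hΛ1 : ∀ D, 1 ≤ D → 1 < Λ D := fun D hD => by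
    have : (1 : ℝ) ≤ D ^ (1 / (2 * (d : ℝ))) := Real.one_le_rpow hD (by positivity)
    simp only [hΛ]
    linarith
  have hΛd : ∀ D, 1 ≤ D → Λ D ^ d = 4 ^ d * √D := fun D hD =>
    four_mul_rpow_pow (by linarith) hd0
  have hΛlt : ∀ D D', 1 ≤ D → D ≤ D' → 2 ^ d * √D < Λ D' ^ d := fun D D' hD hDD' => by
    rw [hΛd D' (hD.trans hDD')]
    have h1 : (2 : ℝ) ^ d < 4 ^ d := pow_lt_pow_left₀ (by norm_num) (by norm_num) hd0
    have h2 : √D ≤ √D' := Real.sqrt_le_sqrt hDD'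
    have h3 : 0 < √D := Real.sqrt_pos.mpr (by linarith)
    exact mul_lt_mul h1 h2 h3 (by positivity)
  set R : ℝ := C₁ * (Λ Y ^ d) ^ (1 + η) * (((d : ℝ) + 1) * Real.log (Λ Y) + 2) ^ d with hR
  set S : ℝ := C₁ * (4 ^ d : ℝ) ^ (1 + η) / c with hS
  have hΛY := hΛ1 Y hY1
  have hlogΛY := Real.log_pos hΛY
  have hR0 : 0 < R := by positivity
  have hS0 : 0 < S := by positivity
  refine ⟨R + S, by positivity, ?_⟩
  intro K _ _ a θ ha1 _ hθ hgen hfin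
  have hDK0 : DK K ≠ 0 := Int.natAbs_ne_zero.mpr (discr_ne_zero K)
  have hDK1 : (1 : ℝ) ≤ DK K := by exact_mod_cast Nat.one_le_iff_ne_zero.mpr hDK0
  set D : ℝ := ((DK K : ℕ) : ℝ) with hDdef
  have hD0 : 0 < D := by linarith
  have hM : ∀ D', 1 ≤ D' → ∀ S : Finset (Ideal (𝓞 K)),
      (∀ I ∈ S, I ≠ ⊥ ∧ (Ideal.absNorm I : ℝ) ≤ Λ D' ^ d) →
      (S.card : ℝ) ≤ C₁ * (Λ D' ^ d) ^ (1 + η) := fun D' hD' S hS =>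
    hA K inferInstance inferInstance hfin S _ (by have := hΛ1 D' hD'; positivity) hS
  rcases le_or_gt D Y with hDY | hDY
  · have h1 := card_torsion_mul_card_le (K := K) hℓ (s := {⊤}) (by simp) (by
      intro P hP Q hQ hPQ
      exact absurd ((Finset.mem_singleton.mp hP).trans (Finset.mem_singleton.mp hQ).symm) hPQ)
      (Λ := Λ Y) (M := C₁ * (Λ Y ^ d) ^ (1 + η)) hΛY (by rw [hfin]; exact hΛlt D Y hDK1 hDY)
      (by rw [hfin]; exact hM Y hY1)
    rw [hfin, Finset.card_singleton, Nat.cast_one, mul_one] at h1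
    have h2 : 1 ≤ D ^ ((1 : ℝ) / 2 - δ + ε) := Real.one_le_rpow hDK1 (by linarith)
    calc _ ≤ R := h1
      _ ≤ R + S := by linarith
      _ ≤ _ := le_mul_of_one_le_right (by positivity) h2
  · obtain ⟨hT1, hlog1⟩ := hD₀ D ((le_max_left _ _).trans hDY.le)
    have hT2 := hT1 (DK K) rfl
    set T := (Finset.Icc 1 ⌊κ * D ^ δ⌋₊).filter fun p : ℕ =>
        (p.Prime ∧ (p : ZMod d) = 2) ∧ ¬ p ∣ DK K with hTdef
    have hX : (κ * D ^ δ) ^ (2 * ℓ * (d - 1)) * B < D := by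
      have hm : 2 * ℓ * (d - 1) ≠ 0 := by
        have : d - 1 ≠ 0 := by omega
        positivity
      have hκ1 : κ ≤ 1 := by
        rw [hκ, div_le_one (by positivity)]
        linarith
      have hDm : (D ^ δ) ^ (2 * ℓ * (d - 1)) = D := by
        rw [← Real.rpow_natCast, ← Real.rpow_mul hD0.le]
        have : δ * ((2 * ℓ * (d - 1) : ℕ) : ℝ) = 1 := by
          have h1 : (d : ℝ) - 1 ≠ 0 := by linarith
          push_cast [Nat.cast_sub (show 1 ≤ d by omega)]
          rw [hδ]
          field_simp
        rw [this, Real.rpow_one]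
      rw [mul_pow, hDm]
      calc κ ^ (2 * ℓ * (d - 1)) * D * B ≤ κ * D * B := by
            gcongr
            exact pow_le_of_le_one hκ0.le hκ1 hm
        _ = D / 2 := by rw [hκ]; field_simp
        _ < D := by linarith
    have h1 := card_torsion_mul_card_primes_le (K := K) hodd hℓ (by omega) hfin hθ hgen
      (X := κ * D ^ δ) (T := T) hX (hΛ1 D hDK1) (hΛlt D D hDK1 le_rfl)
      (hM D hDK1) (by
        intro p hp
        obtain ⟨h2, h3, h4⟩ := Finset.mem_filter.mp hp
        exact ⟨h3.1, (Nat.le_floor_iff (by positivity)).mp (Finset.mem_Icc.mp h2).2, h3.2, h4⟩)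
    rw [hΛd D hDK1] at h1
    have hlog2 : ((d + 1) * Real.log (Λ D) + 2) ^ d ≤ D ^ η := by
      refine le_of_eq_of_le ?_ hlog1
      rw [log_four_mul_rpow hDK1]
      ring
    set N : ℝ := (Nat.card {c : ClassGroup (𝓞 K) // c ^ ℓ = 1} : ℝ) with hN
    have h2 : N * (c * D ^ (δ * (1 - η))) ≤
        C₁ * (4 ^ d : ℝ) ^ (1 + η) * D ^ ((1 + η) / 2 + η) := by
      calc N * (c * D ^ (δ * (1 - η))) ≤ N * T.card := by gcongr
        _ ≤ C₁ * (4 ^ d * √D) ^ (1 + η) * D ^ η := h1.trans (by gcongr)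
        _ = _ := by
          rw [Real.mul_rpow (by positivity) (by positivity), Real.sqrt_eq_rpow,
            ← Real.rpow_mul hD0.le, Real.rpow_add hD0]
          ring_nf
    have h3 : N ≤ S * D ^ ((1 + η) / 2 + η - δ * (1 - η)) := by
      rw [Real.rpow_sub hD0, hS, div_mul_div_comm, le_div_iff₀ (by positivity)]
      exact h2
    have h4 : D ^ ((1 + η) / 2 + η - δ * (1 - η)) ≤ D ^ ((1 : ℝ) / 2 - δ + ε) :=
      Real.rpow_le_rpow_of_exponent_le hDK1 (by
        have := mul_le_mul_of_nonneg_right hδ1 hη0.le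
        linarith)
    exact h3.trans (mul_le_mul (by linarith) h4 (by positivity) (by positivity))
end

section
/- Let d > 1 and let K = ℚ(θ) be a pure field of degree d, where θ^d = a and a = ∏_{i=1}^{d−1} A_i^i with A_1,…,A_{d−1} positive, squarefree and pairwise coprime integers. Then ( ∏_{1 ≤ k ≤ d−1, gcd(k,d)=1} A_k )^{d−1} divides D_K; in particular ( ∏_{gcd(k,d)=1} A_k )^{d−1} ≤ D_K. -/
open NumberField Polynomial

theorem Squarefree.pow_dvd_of_forall_prime_pow_dvd {m n D : ℕ} (hm : Squarefree m)
    (h : ∀ p, p.Prime → p ∣ m → p ^ n ∣ D) : m ^ n ∣ D := by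
  rw [← Nat.prod_primeFactors_of_squarefree hm, ← Finset.prod_pow]
  refine Finset.prod_dvd_of_isRelPrime (fun p hp q hq hpq => ?_) fun p hp =>
    h p (Nat.prime_of_mem_primeFactors hp) (Nat.dvd_of_mem_primeFactors hp)
  rw [Function.onFun, ← Nat.coprime_iff_isRelPrime]
  exact Nat.Coprime.pow _ _ ((Nat.coprime_primes (Nat.prime_of_mem_primeFactors hp)
    (Nat.prime_of_mem_primeFactors hq)).2 hpq)

/-- If `(x)^d = (p)^k (m)` with `gcd(k, d) = 1` and `p ∤ m`, the
ramification index at any prime over `p` is divisible by `d`. -/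
theorem Ideal.pow_dvd_span_natCast_of_pow_eq {R : Type*} [CommRing R] [IsDedekindDomain R]
    [CharZero R] {p k m d : ℕ} (hp : p.Prime) (hkd : k.Coprime d) (hm : ¬ p ∣ m)
    {x : R} (hx : x ^ d = (p : R) ^ k * m) {Q : Ideal R} [Q.IsPrime]
    (hpQ : (p : R) ∈ Q) : Q ^ d ∣ Ideal.span {(p : R)} := by
  have hp0 : (p : R) ≠ 0 := Nat.cast_ne_zero.2 hp.ne_zero
  have hm0 : (m : R) ≠ 0 := Nat.cast_ne_zero.2 fun h => hm (h ▸ dvd_zero p)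
  have hQ : Prime Q := Ideal.prime_of_isPrime (fun h => hp0 (by simpa [h] using hpQ)) ‹_›
  have hmQ : (m : R) ∉ Q := fun h => by
    have hu : IsCoprime (p : R) (m : R) := (hp.coprime_iff_not_dvd.2 hm).cast
    obtain ⟨u, v, huv⟩ := hu
    exact hQ.not_isUnit <| Ideal.isUnit_iff.2 <| (Ideal.eq_top_iff_one _).2 <|
      huv ▸ Q.add_mem (Q.mul_mem_left _ hpQ) (Q.mul_mem_left _ h)
  have hprod : Ideal.span {x} ^ d = Ideal.span {(p : R)} ^ k * Ideal.span {(m : R)} := by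
    rw [Ideal.span_singleton_pow, Ideal.span_singleton_pow, Ideal.span_singleton_mul_span_singleton,
      hx]
  have hps : Ideal.span {(p : R)} ≠ 0 := by simpa using hp0
  have hms : Ideal.span {(m : R)} ≠ 0 := by simpa using hm0
  have hfin := FiniteMultiplicity.of_prime_left hQ hps
  have hpk : Ideal.span {(p : R)} ^ k * Ideal.span {(m : R)} ≠ 0 :=
    mul_ne_zero (pow_ne_zero _ hps) hms
  have key := congrArg (emultiplicity Q) hprod
  rw [emultiplicity_pow hQ, emultiplicity_mul hQ, emultiplicity_pow hQ,
    emultiplicity_eq_zero (b := Ideal.span {(m : R)}).2 (by rwa [Ideal.dvd_span_singleton]), add_zero,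
    hfin.emultiplicity_eq_multiplicity] at key
  refine (hfin.pow_dvd_iff_le_multiplicity).2 (Nat.le_of_dvd ?_ ?_)
  · exact hfin.le_multiplicity_of_pow_dvd (by rwa [pow_one, Ideal.dvd_span_singleton])
  · refine hkd.symm.dvd_of_dvd_mul_left ?_
    rcases eq_or_ne d 0 with rfl | hd
    · rw [Nat.cast_zero, zero_mul] at key
      exact ⟨0, by exact_mod_cast key.symm⟩
    have hxs : Ideal.span {x} ≠ 0 := fun h => hpk (by rw [← hprod, h, zero_pow hd])
    rw [(FiniteMultiplicity.of_prime_left hQ hxs).emultiplicity_eq_multiplicity] at key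
    exact ⟨_, by exact_mod_cast key.symm⟩

/-- A rational prime that divides a `d`-th power in `𝓞 K` to an exponent prime to `d` contributes
at least `p ^ (d - 1)` to the discriminant. -/
theorem NumberField.prime_pow_dvd_natAbs_discr_of_pow_eq (K : Type*) [Field K] [NumberField K]
    {p k m d : ℕ} (hp : p.Prime) (hkd : k.Coprime d) (hm : ¬ p ∣ m)
    {x : 𝓞 K} (hx : x ^ d = (p : 𝓞 K) ^ k * m) : p ^ (d - 1) ∣ (discr K).natAbs := by
  have hpu : Ideal.span {(p : 𝓞 K)} ≠ ⊤ := by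
    rw [Ne, ← Ideal.absNorm_eq_one_iff, Ideal.absNorm_span_natCast]
    exact fun h => hp.ne_one ((Nat.pow_eq_one.1 h).resolve_right Module.finrank_pos.ne')
  obtain ⟨Q, hQ, hle⟩ := Ideal.exists_le_maximal _ hpu
  have hpQ : (p : 𝓞 K) ∈ Q := hle (Ideal.mem_span_singleton_self _)
  have hdvd := Ideal.pow_dvd_span_natCast_of_pow_eq hp hkd hm hx hpQ
  have hpN : p ∣ Ideal.absNorm Q := by
    have h : Ideal.absNorm Q ∣ p ^ Module.finrank ℤ (𝓞 K) := by
      rw [← Ideal.absNorm_span_natCast]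
      exact Ideal.absNorm_dvd_absNorm_of_le hle
    obtain ⟨j, -, hj⟩ := (Nat.dvd_prime_pow hp).1 h
    rw [hj]
    refine dvd_pow_self _ fun h0 => hQ.ne_top ?_
    rw [← Ideal.absNorm_eq_one_iff, hj, h0, pow_zero]
  have hpZ : Prime (p : ℤ) := Nat.prime_iff_prime_int.1 hp
  have : (Ideal.span {(p : ℤ)}).IsMaximal :=
    ((Ideal.span_singleton_prime hpZ.ne_zero).2 hpZ).isMaximal (by simpa using hpZ.ne_zero)
  have hdiff : Q ^ (d - 1) ∣ differentIdeal ℤ (𝓞 K) :=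
    pow_sub_one_dvd_differentIdeal ℤ (p := Ideal.span {(p : ℤ)}) Q d
      (by simpa using hpZ.ne_zero) (by simpa [Ideal.map_span] using hdvd)
  rw [← absNorm_differentIdeal K (𝓞 K)]
  refine (pow_dvd_pow_of_dvd hpN _).trans ?_
  rw [← map_pow]
  exact map_dvd Ideal.absNorm hdiff

/-- `(∏_{(k,d)=1} A_k)^{d-1}` divides `D_K` for a pure field. -/
theorem prodAk_pow_dvd_discr (K : Type*) [Field K] [NumberField K] (d : ℕ) (hd : 1 < d)
    (a : ℕ) (A : ℕ → ℕ) (θ : K)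
    (hsf : ∀ i ∈ Finset.Icc 1 (d - 1), Squarefree (A i) ∧ 0 < A i)
    (hcop : ∀ i ∈ Finset.Icc 1 (d - 1), ∀ j ∈ Finset.Icc 1 (d - 1), i ≠ j →
      Nat.Coprime (A i) (A j))
    (ha : a = ∏ i ∈ Finset.Icc 1 (d - 1), A i ^ i) (ha1 : 1 < a)
    (hθ : θ ^ d = (a : K)) (hgen : IntermediateField.adjoin ℚ {θ} = ⊤)
    (hdeg : Module.finrank ℚ K = d) :
    (∏ k ∈ (Finset.Icc 1 (d - 1)).filter (fun k => Nat.gcd k d = 1), A k) ^ (d - 1) ∣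
        DK K ∧
      (∏ k ∈ (Finset.Icc 1 (d - 1)).filter (fun k => Nat.gcd k d = 1), A k) ^ (d - 1) ≤
        DK K := by
  have hint : IsIntegral ℤ θ := .of_pow (n := d) (by lia) <| by
    rw [hθ]
    exact_mod_cast isIntegral_algebraMap (R := ℤ) (A := K) (x := (a : ℤ))
  obtain ⟨x, rfl⟩ : ∃ x : 𝓞 K, algebraMap (𝓞 K) K x = θ := ⟨⟨θ, hint⟩, rfl⟩
  have hdvd : ∀ k ∈ Finset.Icc 1 (d - 1), k.Coprime d → A k ^ (d - 1) ∣ DK K := by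
    intro k hk hkd
    refine (hsf k hk).1.pow_dvd_of_forall_prime_pow_dvd fun p hp hpA => ?_
    obtain ⟨c, hc⟩ := hpA
    have hpc : ¬ p ∣ c := fun ⟨b, hb⟩ =>
      hp.not_isUnit ((hsf k hk).1 p ⟨b, by rw [hc, hb, mul_assoc]⟩)
    refine NumberField.prime_pow_dvd_natAbs_discr_of_pow_eq K hp hkd
      (m := c ^ k * ∏ i ∈ (Finset.Icc 1 (d - 1)).erase k, A i ^ i) (fun h => ?_)
      (x := x) ?_
    · rcases hp.dvd_mul.1 h with h | h
      · exact hpc (hp.dvd_of_dvd_pow h)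
      · obtain ⟨i, hi, hpi⟩ := (hp.prime.dvd_finsetProd_iff _).1 h
        have hi' := Finset.mem_erase.1 hi
        exact hp.ne_one <| Nat.eq_one_of_dvd_coprimes (hcop i hi'.2 k hk hi'.1)
          (hp.dvd_of_dvd_pow hpi) ⟨c, hc⟩
    · apply RingOfIntegers.coe_injective
      have hprod : a = p ^ k * (c ^ k * ∏ i ∈ (Finset.Icc 1 (d - 1)).erase k, A i ^ i) := by
        rw [ha, ← Finset.mul_prod_erase _ _ hk, hc, mul_pow, mul_assoc]
      rw [hprod] at hθ
      simpa using hθ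
  have hmain : (∏ k ∈ (Finset.Icc 1 (d - 1)).filter (fun k => Nat.gcd k d = 1), A k) ^ (d - 1) ∣
      DK K := by
    rw [← Finset.prod_pow]
    refine Finset.prod_dvd_of_isRelPrime (fun i hi j hj hij => ?_) fun k hk =>
      hdvd k (Finset.mem_filter.1 hk).1 (Finset.mem_filter.1 hk).2
    rw [Function.onFun, ← Nat.coprime_iff_isRelPrime]
    exact (hcop i (Finset.mem_filter.1 hi).1 j (Finset.mem_filter.1 hj).1 hij).pow _ _
  exact ⟨hmain, Nat.le_of_dvd (Int.natAbs_pos.2 (discr_ne_zero K)) hmain⟩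
end

section
/- Let d > 1. There exists a constant C_d > 0 such that every pure field K = ℚ(θ) of degree d, where θ^d = a and a = ∏_{i=1}^{d−1} A_i^i with A_1,…,A_{d−1} positive, squarefree and pairwise coprime integers, satisfies D_K ≤ C_d · (A_1·A_2⋯A_{d−1})^{d−1}. In particular every prime p > d divides D_K with exponent at most d−1. -/
open NumberField Polynomial

/-- The discriminant of a full family of algebraic integers is the discriminant of the field times
the square of an integer. -/
theorem exists_discr_eq_sq_mul_discr (K : Type*) [Field K] [NumberField K] {ι : Type*} [Fintype ι]
    [DecidableEq ι] (hι : Fintype.card ι = Module.finrank ℚ K) (b : ι → 𝓞 K) :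
    ∃ m : ℤ, Algebra.discr ℚ (fun i => (b i : K)) = ((m ^ 2 * discr K : ℤ) : ℚ) := by
  have e : Module.Free.ChooseBasisIndex ℤ (𝓞 K) ≃ ι := Fintype.equivOfCardEq <| by
    rw [hι, Module.finrank_eq_card_basis (integralBasis K)]
  let c := (integralBasis K).reindex e
  let P : Matrix ι ι ℤ := fun i j => (RingOfIntegers.basis K).repr (b j) (e.symm i)
  have hP : c.toMatrix (fun i => (b i : K)) = P.map (Int.castRingHom ℚ) := by
    ext i j
    simp only [c, Module.Basis.toMatrix_apply, Module.Basis.repr_reindex_apply]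
    exact integralBasis_repr_apply K (b j) (e.symm i)
  refine ⟨P.det, ?_⟩
  rw [← c.toMatrix_map_vecMul (fun i => (b i : K)), Algebra.discr_of_matrix_vecMul, hP,
    ← RingHom.mapMatrix_apply, ← RingHom.map_det, Module.Basis.coe_reindex,
    Algebra.discr_reindex, ← coe_discr]
  simp

theorem Algebra.discr_smul {A B ι : Type*} [CommRing A] [CommRing B] [Algebra A B] [Fintype ι]
    [DecidableEq ι] (c : ι → A) (b : ι → B) :
    Algebra.discr A (fun i => c i • b i) = (∏ i, c i) ^ 2 * Algebra.discr A b := by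
  rw [← Matrix.det_diagonal, ← Algebra.discr_of_matrix_vecMul]
  congr 1
  ext i
  rw [Matrix.diagonal_map (map_zero _), Matrix.vecMul_diagonal, Algebra.smul_def, mul_comm]

/-- The discriminant of the power basis of a pure extension, up to sign. -/
theorem PowerBasis.abs_discr_of_pow_dim_eq {K : Type*} [Field K] [NumberField K]
    (pb : PowerBasis ℚ K) {a : ℕ} (h : pb.gen ^ pb.dim = (a : K)) :
    |Algebra.discr ℚ pb.basis| = (pb.dim : ℚ) ^ pb.dim * (a : ℚ) ^ (pb.dim - 1) := by
  have hpos : 0 < pb.dim := pb.dim_pos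
  have hmin : minpoly ℚ pb.gen = X ^ pb.dim - C (a : ℚ) := by
    refine (minpoly.unique' _ _ (monic_X_pow_sub_C _ hpos.ne') (by simp [h]) fun q hq => ?_).symm
    rw [degree_X_pow_sub_C hpos] at hq
    by_cases hq0 : q = 0
    · exact .inl hq0
    · exact .inr fun h0 => (pb.dim_le_degree_of_root hq0 h0).not_gt hq
  have hnorm : |Algebra.norm ℚ pb.gen| = (a : ℚ) := by
    refine (pow_left_inj₀ (abs_nonneg _) a.cast_nonneg hpos.ne').mp ?_
    rw [← abs_pow, ← map_pow, h, ← map_natCast (algebraMap ℚ K), Algebra.norm_algebraMap,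
      pb.finrank, abs_of_nonneg (by positivity)]
  rw [Algebra.discr_powerBasis_eq_norm, hmin]
  have : aeval pb.gen (derivative (X ^ pb.dim - C (a : ℚ)))
      = algebraMap ℚ K pb.dim * pb.gen ^ (pb.dim - 1) := by
    simp [derivative_X_pow]
  rw [this, map_mul, map_pow, Algebra.norm_algebraMap, pb.finrank, abs_mul, abs_mul, abs_pow,
    abs_pow, abs_neg, abs_one, one_pow, one_mul, abs_pow, hnorm, Nat.abs_cast]

theorem Nat.mul_pred_le_two_mul_sum_div {d i : ℕ} (hd : 0 < d) :
    (i - 1) * (d - 1) ≤ 2 * ∑ k ∈ Finset.range d, i * k / d := by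
  obtain ⟨n, rfl⟩ : ∃ n, d = n + 1 := ⟨d - 1, by omega⟩
  have hrefl := Finset.sum_range_reflect (fun k => i * (k + 1) / (n + 1)) n
  rw [Finset.sum_range_succ', two_mul]
  simp only [mul_zero, Nat.zero_div, add_zero, Nat.add_sub_cancel]
  nth_rewrite 1 [← hrefl]
  rw [← Finset.sum_add_distrib, mul_comm]
  calc n * (i - 1) = ∑ _k ∈ Finset.range n, (i - 1) := by simp
    _ ≤ _ := Finset.sum_le_sum fun k hk => ?_
  have hk := Finset.mem_range.mp hk
  have h1 : i * (n - 1 - k + 1) + i * (k + 1) = i * (n + 1) := by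
    rw [← mul_add]; congr 1; omega
  have h2 := Nat.div_add_mod (i * (n - 1 - k + 1)) (n + 1)
  have h3 := Nat.div_add_mod (i * (k + 1)) (n + 1)
  have h4 := Nat.mod_lt (i * (n - 1 - k + 1)) n.succ_pos
  have h5 := Nat.mod_lt (i * (k + 1)) n.succ_pos
  have : i < i * (n - 1 - k + 1) / (n + 1) + i * (k + 1) / (n + 1) + 2 := by
    refine Nat.lt_of_mul_lt_mul_left (a := n + 1) ?_
    simp only [Nat.succ_eq_add_one] at h4 h5
    linarith
  exact Nat.sub_le_of_le_add (by lia)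

theorem PowerBasis.natAbs_discr_dvd_of_pow_dim_eq {K : Type*} [Field K] [NumberField K]
    (pb : PowerBasis ℚ K) {A : ℕ → ℕ} {s : Finset ℕ} (hs : ∀ i ∈ s, 0 < i)
    (hA : ∀ i ∈ s, 0 < A i) (h : pb.gen ^ pb.dim = ((∏ i ∈ s, A i ^ i : ℕ) : K)) :
    (discr K).natAbs ∣ pb.dim ^ pb.dim * (∏ i ∈ s, A i) ^ (pb.dim - 1) := by
  set d := pb.dim with hd
  have hpos : 0 < d := pb.dim_pos
  let B : ℕ → ℕ := fun k => ∏ i ∈ s, A i ^ (i * k / d)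
  have hB : ∀ k, 0 < B k := fun k => Finset.prod_pos fun i hi => pow_pos (hA i hi) _
  have hBK : ∀ k, (B k : K) ≠ 0 := fun k => by exact_mod_cast (hB k).ne'
  have hBpow : ∀ k, (∏ i ∈ s, A i ^ i) ^ k = B k ^ d * ∏ i ∈ s, A i ^ (i * k % d) := fun k => by
    simp only [B, ← Finset.prod_pow, ← Finset.prod_mul_distrib, ← pow_mul, ← pow_add]
    exact Finset.prod_congr rfl fun i _ => by rw [Nat.div_add_mod']
  have hint : ∀ k : Fin d, IsIntegral ℤ (pb.gen ^ (k : ℕ) / B k) := fun k => by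
    refine IsIntegral.of_pow hpos ?_
    rw [div_pow, pow_right_comm, h, ← Nat.cast_pow, hBpow, Nat.cast_mul, Nat.cast_pow,
      mul_div_cancel_left₀ _ (pow_ne_zero _ (hBK k))]
    exact isIntegral_natCast _
  obtain ⟨m, hm⟩ := exists_discr_eq_sq_mul_discr K (ι := Fin d) (by rw [pb.finrank]; simp [hd])
    fun k => ⟨_, hint k⟩
  have hdisc := Algebra.discr_smul (fun k : Fin d => (B k : ℚ)) fun k => pb.gen ^ (k : ℕ) / B k
  have hbasis : (fun k : Fin d => (B k : ℚ) • (pb.gen ^ (k : ℕ) / (B k : K))) = pb.basis := by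
    ext k
    rw [Algebra.smul_def, map_natCast, mul_div_cancel₀ _ (hBK k), pb.basis_eq_pow]
  rw [hbasis] at hdisc
  have habs := pb.abs_discr_of_pow_dim_eq h
  change Algebra.discr ℚ (fun k : Fin d => pb.gen ^ (k : ℕ) / (B k : K)) = _ at hm
  rw [hdisc, hm] at habs
  have hnat : (∏ k ∈ Finset.range d, B k) ^ 2 * (m.natAbs ^ 2 * (discr K).natAbs)
      = d ^ d * (∏ i ∈ s, A i ^ i) ^ (d - 1) := by
    rw [← Fin.prod_univ_eq_prod_range]
    have : ((((∏ k : Fin d, B k : ℕ) : ℤ) ^ 2 * (m ^ 2 * discr K)).natAbs : ℚ)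
        = ((d ^ d * (∏ i ∈ s, A i ^ i) ^ (d - 1) : ℕ) : ℚ) := by
      rw [Nat.cast_natAbs]
      push_cast
      push_cast at habs
      exact habs
    rw [← Nat.cast_injective this]
    simp only [Int.natAbs_mul, Int.natAbs_pow, Int.natAbs_natCast]
  have hBsq : ∏ i ∈ s, A i ^ ((i - 1) * (d - 1)) ∣ (∏ k ∈ Finset.range d, B k) ^ 2 := by
    simp only [B]
    rw [Finset.prod_comm, ← Finset.prod_pow]
    refine Finset.prod_dvd_prod_of_dvd _ _ fun i _ => ?_
    rw [Finset.prod_pow_eq_pow_sum, ← pow_mul, mul_comm _ 2]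
    exact pow_dvd_pow _ (Nat.mul_pred_le_two_mul_sum_div hpos)
  have hsplit : (∏ i ∈ s, A i ^ i) ^ (d - 1)
      = (∏ i ∈ s, A i ^ ((i - 1) * (d - 1))) * (∏ i ∈ s, A i) ^ (d - 1) := by
    simp only [← Finset.prod_pow, ← Finset.prod_mul_distrib, ← pow_mul, ← pow_add]
    refine Finset.prod_congr rfl fun i hi => ?_
    rw [← Nat.succ_mul, Nat.succ_eq_add_one, Nat.sub_add_cancel (hs i hi)]
  refine Nat.dvd_of_mul_dvd_mul_left
    (Finset.prod_pos fun i hi => pow_pos (hA i hi) ((i - 1) * (d - 1))) ?_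
  rw [mul_left_comm, ← hsplit, ← hnat]
  exact mul_dvd_mul hBsq (dvd_mul_left _ _)

/-- `D_K ≤ C_d (A₁ ⋯ A_{d-1})^{d-1}` for a pure field, and primes `p > d`
divide `D_K` with exponent at most `d - 1`. -/
theorem discr_upper_pure_field (d : ℕ) (hd : 1 < d) :
    ∃ C : ℝ, 0 < C ∧
      ∀ (K : Type) (_ : Field K) (_ : NumberField K) (a : ℕ) (A : ℕ → ℕ) (θ : K),
        (∀ i ∈ Finset.Icc 1 (d - 1), Squarefree (A i) ∧ 0 < A i) →
        (∀ i ∈ Finset.Icc 1 (d - 1), ∀ j ∈ Finset.Icc 1 (d - 1), i ≠ j →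
          Nat.Coprime (A i) (A j)) →
        a = ∏ i ∈ Finset.Icc 1 (d - 1), A i ^ i → 1 < a →
        θ ^ d = (a : K) → IntermediateField.adjoin ℚ {θ} = ⊤ →
        Module.finrank ℚ K = d →
        (DK K : ℝ) ≤ C * ((∏ i ∈ Finset.Icc 1 (d - 1), A i : ℕ) : ℝ) ^ (d - 1) ∧
        ∀ p : ℕ, p.Prime → d < p → (DK K).factorization p ≤ d - 1 := by
  have hd0 : 0 < d := by omega
  refine ⟨(d : ℝ) ^ d, by positivity, ?_⟩
  intro K _ _ a A θ hA hcop ha _ hθ htop hrank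
  have hθint : IsIntegral ℚ θ := Algebra.IsIntegral.isIntegral θ
  have hadj : Algebra.adjoin ℚ {θ} = ⊤ := by
    rw [← IntermediateField.adjoin_simple_toSubalgebra_of_isAlgebraic hθint.isAlgebraic, htop,
      IntermediateField.top_toSubalgebra]
  let pb := PowerBasis.ofAdjoinEqTop hθint hadj
  have hgen : pb.gen = θ := PowerBasis.ofAdjoinEqTop_gen hθint hadj
  have hdim : pb.dim = d := by rw [← pb.finrank, hrank]
  have hdvd : DK K ∣ d ^ d * (∏ i ∈ Finset.Icc 1 (d - 1), A i) ^ (d - 1) := by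
    have := pb.natAbs_discr_dvd_of_pow_dim_eq (A := A) (s := Finset.Icc 1 (d - 1))
      (fun i hi => (Finset.mem_Icc.mp hi).1) (fun i hi => (hA i hi).2)
      (by rw [hgen, hdim, hθ, ha])
    rwa [hdim] at this
  have hprod : 0 < ∏ i ∈ Finset.Icc 1 (d - 1), A i := Finset.prod_pos fun i hi => (hA i hi).2
  refine ⟨by exact_mod_cast Nat.le_of_dvd (by positivity) hdvd, fun p hp hdp => ?_⟩
  have hsq : Squarefree (∏ i ∈ Finset.Icc 1 (d - 1), A i) :=
    Finset.squarefree_prod_of_pairwise_isCoprime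
      (fun i hi j hj hij => Nat.coprime_iff_isRelPrime.mp (hcop i hi j hj hij))
      fun i hi => (hA i hi).1
  calc (DK K).factorization p
      ≤ (d ^ d * (∏ i ∈ Finset.Icc 1 (d - 1), A i) ^ (d - 1)).factorization p :=
        (Nat.factorization_le_iff_dvd (Int.natAbs_ne_zero.mpr (discr_ne_zero K))
          (by positivity)).mpr hdvd p
    _ = (d - 1) * (∏ i ∈ Finset.Icc 1 (d - 1), A i).factorization p := by
        rw [Nat.factorization_mul (by positivity) (by positivity), Nat.factorization_pow,
          Nat.factorization_pow]
        simp [Nat.factorization_eq_zero_of_lt hdp]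
    _ ≤ d - 1 := mul_le_of_le_one_right (Nat.zero_le _) (hsq.natFactorization_le_one p)
end

section
/- Let d > 1 and let K = ℚ(θ) be a pure field of degree d, where θ is a root of an irreducible polynomial x^d − a ∈ ℤ[x] with a > 1 free of d-th powers. Then every rational prime p dividing a ramifies in K/ℚ; that is, there is a prime ideal 𝔭 of 𝓞_K with 𝔭² dividing p𝓞_K. -/
open NumberField Polynomial

/-- every prime dividing `a` ramifies in the pure field `ℚ(a^{1/d})`. -/
theorem ramified_of_dvd (K : Type*) [Field K] [NumberField K] (d : ℕ) (hd : 1 < d)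
    (a : ℕ) (ha : 1 < a) (hfree : ∀ p : ℕ, p.Prime → ¬ p ^ d ∣ a)
    (hirr : Irreducible ((Polynomial.X : ℚ[X]) ^ d - Polynomial.C (a : ℚ)))
    (θ : K) (hθ : θ ^ d = (a : K)) (hgen : IntermediateField.adjoin ℚ {θ} = ⊤)
    (hdeg : Module.finrank ℚ K = d)
    (p : ℕ) (hp : p.Prime) (hpa : p ∣ a) :
    ∃ 𝔭 : Ideal (𝓞 K), 𝔭.IsPrime ∧ 𝔭 ≠ ⊥ ∧ 𝔭 ^ 2 ∣ Ideal.span {(p : 𝓞 K)} := by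
  obtain ⟨k, m, hpm, rfl⟩ := Nat.exists_eq_pow_mul_and_not_dvd (by lia : a ≠ 0) p hp.ne_one
  have hkd : k < d := by
    by_contra! h
    exact hfree p hp ((pow_dvd_pow p h).mul_right m)
  have hk0 : k ≠ 0 := by
    rintro rfl
    exact hpm (by simpa using hpa)
  have hint : IsIntegral ℤ θ := by
    refine IsIntegral.of_pow (n := d) (by lia) ?_
    rw [hθ]
    exact_mod_cast isIntegral_algebraMap (R := ℤ) (A := K) (x := ((p ^ k * m : ℕ) : ℤ))
  obtain ⟨t, rfl⟩ : ∃ t : 𝓞 K, (t : K) = θ := ⟨⟨θ, hint⟩, rfl⟩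
  have ht : t ^ d = (p : 𝓞 K) ^ k * (m : 𝓞 K) := by
    apply RingOfIntegers.coe_injective
    simpa using hθ
  have hunit : ¬ IsUnit (p : 𝓞 K) := by
    intro h
    have hnorm := h.map (Algebra.norm ℤ)
    rw [show (p : 𝓞 K) = algebraMap ℤ (𝓞 K) p by simp, Algebra.norm_algebraMap,
      isUnit_pow_iff Module.finrank_pos.ne', Int.isUnit_iff_natAbs_eq] at hnorm
    exact hp.ne_one (by simpa using hnorm)
  obtain ⟨P, hP, hpP⟩ := exists_max_ideal_of_mem_nonunits hunit
  have hp0 : (p : 𝓞 K) ≠ 0 := by exact_mod_cast hp.ne_zero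
  have hPbot : P ≠ ⊥ := by
    rintro rfl
    exact hp0 (by simpa using hpP)
  refine ⟨P, hP.isPrime, hPbot, ?_⟩
  by_contra hsq
  have hprime : Prime P := Ideal.prime_of_isPrime hPbot hP.isPrime
  have hep : emultiplicity P (Ideal.span {(p : 𝓞 K)}) = 1 := by
    refine emultiplicity_eq_coe (n := 1).2 ⟨?_, hsq⟩
    simpa using hpP
  have hem : emultiplicity P (Ideal.span {(m : 𝓞 K)}) = 0 := by
    refine emultiplicity_eq_zero.2 fun h => hP.ne_top ?_
    rw [Ideal.dvd_span_singleton] at h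
    obtain ⟨u, v, huv⟩ := Nat.isCoprime_iff_coprime.2 ((Nat.Prime.coprime_iff_not_dvd hp).2 hpm)
    rw [Ideal.eq_top_iff_one]
    have huv' : (u : 𝓞 K) * p + v * m = 1 := by exact_mod_cast congrArg (Int.cast : ℤ → 𝓞 K) huv
    rw [← huv']
    exact P.add_mem (P.mul_mem_left _ hpP) (P.mul_mem_left _ h)
  have hval := congrArg (fun x : 𝓞 K => emultiplicity P (Ideal.span {x})) ht
  simp only [← Ideal.span_singleton_mul_span_singleton, ← Ideal.span_singleton_pow,
    emultiplicity_mul hprime, emultiplicity_pow hprime, hep, hem, mul_one, add_zero] at hval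
  cases he : emultiplicity P (Ideal.span {t}) with
  | top =>
    rw [he, ENat.mul_top (by exact_mod_cast (by lia : d ≠ 0))] at hval
    exact ENat.top_ne_natCast k hval
  | coe n =>
    rw [he] at hval
    have hdk : d * n = k := by exact_mod_cast hval
    exact hkd.not_ge (Nat.le_of_dvd (Nat.pos_of_ne_zero hk0) ⟨n, hdk.symm⟩)
end

section
/- Let a, d, m be positive integers and let r be a nonzero rational number written in lowest terms as r = D_0/D with D ≥ 1 and gcd(D_0, D) = 1. If r · a^{m/d} is an algebraic integer, where a^{m/d} denotes the positive real d-th root of a raised to the m-th power, then for every prime p one has d · ord_p(D) ≤ m · ord_p(a); in particular D divides ∏_{p | a} p^{⌊ m·ord_p(a)/d ⌋}, and every prime dividing D divides a. -/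
open NumberField Polynomial

/-- If a natural number times a power of a rational is an integer, then the power of the
denominator divides that number. -/
theorem Rat.den_pow_dvd_of_pow_mul_eq_intCast {r : ℚ} {d b : ℕ} {z : ℤ}
    (h : r ^ d * b = z) : r.den ^ d ∣ b := by
  have hden : (r.den : ℚ) ≠ 0 := by exact_mod_cast r.den_nz
  have hz : r.num ^ d * (b : ℤ) = z * (r.den : ℤ) ^ d := by
    have hq : (r.num : ℚ) ^ d * b = z * (r.den : ℚ) ^ d := by
      rw [← h, ← Rat.mul_den_eq_num r]
      ring
    exact_mod_cast hq
  have hdvd : r.den ^ d ∣ r.num.natAbs ^ d * b := by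
    have := Int.natAbs_dvd_natAbs.mpr (Dvd.intro_left z hz.symm)
    simpa [Int.natAbs_mul, Int.natAbs_pow] using this
  exact (r.reduced.symm.pow d d).dvd_of_dvd_mul_left hdvd

/-- If `r * a ^ (m / d)` is an algebraic integer, then `r.den ^ d` divides `a ^ m`. -/
theorem den_pow_dvd_pow_of_isIntegral {a d m : ℕ} (hd : d ≠ 0) {r : ℚ}
    (hint : IsIntegral ℤ ((r : ℝ) * (a : ℝ) ^ ((m : ℝ) / (d : ℝ)))) :
    r.den ^ d ∣ a ^ m := by
  have hpow : ((r : ℝ) * (a : ℝ) ^ ((m : ℝ) / (d : ℝ))) ^ d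
      = algebraMap ℚ ℝ (r ^ d * (a ^ m : ℕ)) := by
    have hd' : (d : ℝ) ≠ 0 := by exact_mod_cast hd
    rw [mul_pow, ← Real.rpow_mul_natCast a.cast_nonneg, div_mul_cancel₀ _ hd',
      Real.rpow_natCast]
    simp
  have hq := hint.pow d
  rw [hpow, isIntegral_algebraMap_iff (algebraMap ℚ ℝ).injective] at hq
  obtain ⟨z, hz⟩ := IsIntegrallyClosed.isIntegral_iff.mp hq
  exact Rat.den_pow_dvd_of_pow_mul_eq_intCast (by simpa using hz.symm)

/-- if `r·a^{m/d}` is an algebraic integer, `r = D₀/D` in lowest terms, then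
`d·ord_p(D) ≤ m·ord_p(a)` for all primes, `D ∣ ∏_{p ∣ a} p^{⌊m·ord_p(a)/d⌋}`, and every
prime dividing `D` divides `a`. -/
theorem den_dvd_of_isIntegral (a d m : ℕ) (ha : 0 < a) (hd : 0 < d) (hm : 0 < m)
    (r : ℚ) (hr : r ≠ 0)
    (hint : IsIntegral ℤ ((r : ℝ) * (a : ℝ) ^ ((m : ℝ) / (d : ℝ)))) :
    (∀ p : ℕ, p.Prime → d * r.den.factorization p ≤ m * a.factorization p) ∧
    r.den ∣ ∏ p ∈ a.primeFactors, p ^ (m * a.factorization p / d) ∧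
    (∀ p : ℕ, p.Prime → p ∣ r.den → p ∣ a) := by
  have hdvd := den_pow_dvd_pow_of_isIntegral hd.ne' hint
  have hord (p : ℕ) : d * r.den.factorization p ≤ m * a.factorization p := by
    simpa using (Nat.factorization_le_iff_dvd (pow_ne_zero d r.den_nz)
      (pow_ne_zero m ha.ne')).mpr hdvd p
  have hprime (p : ℕ) (hp : p.Prime) (hpr : p ∣ r.den) : p ∣ a :=
    hp.dvd_of_dvd_pow ((dvd_pow hpr hd.ne').trans hdvd)
  refine ⟨fun p _ => hord p, ?_, hprime⟩
  have hsub : r.den.primeFactors ⊆ a.primeFactors := fun p hp =>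
    Nat.mem_primeFactors.mpr ⟨Nat.prime_of_mem_primeFactors hp,
      hprime p (Nat.prime_of_mem_primeFactors hp) (Nat.dvd_of_mem_primeFactors hp), ha.ne'⟩
  calc r.den = ∏ p ∈ r.den.primeFactors, p ^ r.den.factorization p :=
        (Nat.prod_factorization_pow_eq_self r.den_nz).symm
    _ ∣ ∏ p ∈ r.den.primeFactors, p ^ (m * a.factorization p / d) :=
        Finset.prod_dvd_prod_of_dvd _ _ fun p _ =>
          pow_dvd_pow p ((Nat.le_div_iff_mul_le hd).mpr (by rw [mul_comm]; exact hord p))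
    _ ∣ ∏ p ∈ a.primeFactors, p ^ (m * a.factorization p / d) :=
        Finset.prod_dvd_prod_of_subset _ _ _ hsub
end

section
/- Let d > 1 and let A, B be squarefree coprime positive integers with B ≤ A ≤ 2B, set a = A·B^{d−1} > 1, and suppose x^d − a is irreducible over ℚ. Let K = ℚ(a^{1/d}) with a^{1/d} the positive real d-th root, and let α = a^{1/d}/B. Then α generates K over ℚ, H_K(α) = A, and consequently η(K) ≤ √2 · D_K^{1/(2(d−1))}. -/
open NumberField Polynomial

theorem Squarefree.pow_dvd_of_forall_prime {α : Type*} [CommMonoidWithZero α]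
    [UniqueFactorizationMonoid α] {x z : α} {k : ℕ} (hx : Squarefree x)
    (h : ∀ p, Prime p → p ∣ x → p ^ k ∣ z) : x ^ k ∣ z := by
  induction x using UniqueFactorizationMonoid.induction_on_prime with
  | h₁ =>
    rcases subsingleton_or_nontrivial α with _ | _
    · exact ⟨1, Subsingleton.elim _ _⟩
    · exact absurd hx not_squarefree_zero
  | h₂ x hx' => exact (hx'.pow k).dvd
  | h₃ x p _ hp ih =>
    rw [mul_pow]
    exact (IsRelPrime.of_squarefree_mul hx).pow.mul_dvd (h p hp (dvd_mul_right p x))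
      (ih hx.of_mul_right fun q hq hqx ↦ h q hq (hqx.mul_left p))

theorem Ideal.exists_factorization_of_pow_eq {R : Type*} [CommRing R] [IsDedekindDomain R]
    {d : ℕ} (hd : d ≠ 0) {t x b : R} (hb : b ≠ 0) (hxb : IsCoprime x b)
    (h : t ^ d = x * b ^ (d - 1)) :
    ∃ I J L : Ideal R, I ≠ 0 ∧ Ideal.span {b} = I * J ∧ Ideal.span {t} = I * L ∧
      IsCoprime J L ∧ J ^ d = Ideal.span {b} ∧ L ^ d = Ideal.span {x} := by
  have hb' : Ideal.span {b} ≠ 0 := by simpa using hb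
  set I := Ideal.span {b} ⊔ Ideal.span {t}
  obtain ⟨J, hJ⟩ : I ∣ Ideal.span {b} := Ideal.dvd_iff_le.mpr le_sup_left
  obtain ⟨L, hL⟩ : I ∣ Ideal.span {t} := Ideal.dvd_iff_le.mpr le_sup_right
  have hI0 : I ≠ 0 := fun h0 ↦ hb' (by rw [hJ, h0, zero_mul])
  have hJL : IsCoprime J L := by
    rw [Ideal.isCoprime_iff_sup_eq, ← Ideal.one_eq_top]
    apply mul_left_cancel₀ hI0
    rw [Ideal.mul_sup, ← hJ, ← hL, mul_one]
  have hxb' : Ideal.span {b} ⊔ Ideal.span {x} = ⊤ := by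
    rw [← Ideal.isCoprime_iff_sup_eq, Ideal.isCoprime_span_singleton_iff]
    exact hxb.symm
  have hbd : Ideal.span {b} ^ d = Ideal.span {b} ^ (d - 1) * Ideal.span {b} :=
    (pow_sub_one_mul hd _).symm
  have htd : Ideal.span {t} ^ d = Ideal.span {b} ^ (d - 1) * Ideal.span {x} := by
    rw [Ideal.span_singleton_pow, h, mul_comm, ← Ideal.span_singleton_mul_span_singleton,
      Ideal.span_singleton_pow]
  have hId : I ^ d = Ideal.span {b} ^ (d - 1) := by
    have hc := Ideal.isCoprime_iff_sup_eq.mp (hJL.pow (m := d) (n := d))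
    calc I ^ d = I ^ d * (J ^ d ⊔ L ^ d) := by rw [hc, ← Ideal.one_eq_top, mul_one]
      _ = Ideal.span {b} ^ (d - 1) * (Ideal.span {b} ⊔ Ideal.span {x}) := by
        rw [Ideal.mul_sup, ← mul_pow, ← mul_pow, ← hJ, ← hL, hbd, htd, Ideal.mul_sup]
      _ = _ := by rw [hxb', ← Ideal.one_eq_top, mul_one]
  refine ⟨I, J, L, hI0, hJ, hL, hJL, ?_, ?_⟩
  · apply mul_left_cancel₀ (pow_ne_zero d hI0)
    rw [← mul_pow, ← hJ, hId, hbd]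
  · apply mul_left_cancel₀ (pow_ne_zero d hI0)
    rw [← mul_pow, ← hL, hId, htd]

section

variable {K : Type*} [Field K] [NumberField K]

theorem absNorm_eq_of_pow_finrank_eq {I : Ideal (𝓞 K)} {n : ℕ}
    (h : I ^ Module.finrank ℚ K = Ideal.span {(n : 𝓞 K)}) : Ideal.absNorm I = n := by
  apply Nat.pow_left_injective (Module.finrank_pos (R := ℚ) (M := K)).ne'
  simp only
  rw [← map_pow, h, Ideal.absNorm_span_natCast, RingOfIntegers.rank]

theorem pow_finrank_sub_one_dvd_discr {I : Ideal (𝓞 K)} {n : ℕ} (hn : Squarefree n)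
    (h : I ^ Module.finrank ℚ K = Ideal.span {(n : 𝓞 K)}) :
    n ^ (Module.finrank ℚ K - 1) ∣ (discr K).natAbs := by
  have hnorm := absNorm_eq_of_pow_finrank_eq h
  have hsq : Squarefree I := by
    intro P hP
    have := Ideal.absNorm_dvd_absNorm_of_le (Ideal.dvd_iff_le.mp hP)
    rw [hnorm, map_mul] at this
    rw [Ideal.isUnit_iff, ← Ideal.absNorm_eq_one_iff]
    exact Nat.isUnit_iff.mp (hn _ this)
  have key : I ^ (Module.finrank ℚ K - 1) ∣ differentIdeal ℤ (𝓞 K) := by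
    refine hsq.pow_dvd_of_forall_prime fun P hP hPI ↦ ?_
    have hPmax : P.IsMaximal := (Ideal.isPrime_of_prime hP).isMaximal hP.ne_zero
    obtain ⟨p, m, hm, hpP, hp, hPp⟩ := Ideal.exists_prime_and_absNorm_eq_pow P
    have hpn : p ∣ n := by
      rw [← hnorm]
      exact (dvd_pow_self p hm.ne').trans
        (hPp ▸ Ideal.absNorm_dvd_absNorm_of_le (Ideal.dvd_iff_le.mp hPI))
    obtain ⟨q, rfl⟩ := hpn
    have hcop : Nat.Coprime p q := Nat.coprime_of_squarefree_mul hn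
    have hpq : IsCoprime (p : 𝓞 K) (q : 𝓞 K) := hcop.cast
    have hPq : IsCoprime P (Ideal.span {(q : 𝓞 K)}) := by
      rw [Ideal.isCoprime_iff_sup_eq, eq_top_iff,
        ← Ideal.isCoprime_iff_sup_eq.mp ((Ideal.isCoprime_span_singleton_iff _ _).mpr hpq)]
      exact sup_le_sup_right ((Ideal.span_singleton_le_iff_mem P).mpr hpP) _
    have hdvd : P ^ Module.finrank ℚ K ∣ Ideal.span {(p : 𝓞 K)} := by
      have h1 := pow_dvd_pow_of_dvd hPI (Module.finrank ℚ K)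
      rw [h, Nat.cast_mul, ← Ideal.span_singleton_mul_span_singleton] at h1
      exact hPq.pow_left.dvd_of_dvd_mul_right h1
    have hp0 : (p : ℤ) ≠ 0 := by exact_mod_cast hp.ne_zero
    have : (Ideal.span {(p : ℤ)}).IsMaximal :=
      ((Ideal.span_singleton_prime hp0).mpr (Nat.prime_iff_prime_int.mp hp)).isMaximal
        (by simpa using hp0)
    refine pow_sub_one_dvd_differentIdeal ℤ P (p := Ideal.span {(p : ℤ)}) _ (by simpa using hp0) ?_
    simpa [Ideal.map_span] using hdvd
  have := Ideal.absNorm_dvd_absNorm_of_le (Ideal.dvd_iff_le.mp key)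
  rwa [map_pow, hnorm, NumberField.absNorm_differentIdeal K] at this

theorem denIdeal_div_eq {t b : 𝓞 K} (hb : b ≠ 0) {I J L : Ideal (𝓞 K)} (hI : I ≠ 0)
    (hIJ : Ideal.span {b} = I * J) (hIL : Ideal.span {t} = I * L) (hJL : IsCoprime J L) :
    denIdeal K ((t : K) / (b : K)) = J := by
  have hb' : (b : K) ≠ 0 := by simpa using hb
  ext x
  have hmem : x ∈ denIdeal K ((t : K) / (b : K)) ↔ b ∣ x * t := by
    refine exists_congr fun y ↦ ?_
    rw [← mul_div_assoc, div_eq_iff hb', mul_comm (y : K), RingOfIntegers.ext_iff]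
    push_cast
    rfl
  rw [hmem, ← Ideal.span_singleton_le_span_singleton, ← Ideal.dvd_iff_le,
    ← Ideal.span_singleton_mul_span_singleton, hIJ, hIL, mul_left_comm,
    mul_dvd_mul_iff_left hI, ← Ideal.dvd_span_singleton]
  exact ⟨hJL.dvd_of_dvd_mul_right, fun h ↦ h.mul_right L⟩

theorem prod_max_one_eq_of_pow_finrank_eq {α : K} {q : ℚ} (hq : 1 ≤ q)
    (h : α ^ Module.finrank ℚ K = (q : K)) :
    ∏ w : InfinitePlace K, max 1 (w α) ^ w.mult = (q : ℝ) := by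
  have hd := (Module.finrank_pos (R := ℚ) (M := K)).ne'
  have hw (w : InfinitePlace K) : w α ^ Module.finrank ℚ K = (q : ℝ) := by
    rw [← map_pow, h, ← InfinitePlace.norm_embedding_eq, map_ratCast, Complex.norm_ratCast]
    exact_mod_cast abs_of_nonneg (zero_le_one.trans hq)
  have hw1 (w : InfinitePlace K) : 1 ≤ w α := by
    rw [← one_le_pow_iff_of_nonneg (apply_nonneg w α) hd, hw]
    exact_mod_cast hq
  simp only [max_eq_right (hw1 _)]
  refine (pow_left_inj₀ (Finset.prod_nonneg fun w _ ↦ pow_nonneg (apply_nonneg w α) _)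
    (by exact_mod_cast zero_le_one.trans hq) hd).mp ?_
  simp_rw [← Finset.prod_pow, pow_right_comm _ _ (Module.finrank ℚ K), hw]
  rw [Finset.prod_pow_eq_pow_sum, InfinitePlace.sum_mult_eq]

theorem etaK_le_heightK {α : K} (h : IntermediateField.adjoin ℚ {α} = ⊤) :
    etaK K ≤ heightK K α := by
  refine csInf_le ⟨0, ?_⟩ ⟨α, h, rfl⟩
  rintro _ ⟨β, -, rfl⟩
  exact mul_nonneg (Nat.cast_nonneg _) (Finset.prod_nonneg fun w _ ↦ by positivity)

theorem IntermediateField.adjoin_div_natCast_eq_top {θ : K}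
    (h : IntermediateField.adjoin ℚ {θ} = ⊤) {n : ℕ} (hn : n ≠ 0) :
    IntermediateField.adjoin ℚ {θ / (n : K)} = ⊤ := by
  rw [eq_top_iff, ← h, IntermediateField.adjoin_simple_le_iff]
  have := mul_mem (IntermediateField.mem_adjoin_simple_self ℚ (θ / (n : K))) (natCast_mem _ n)
  rwa [div_mul_cancel₀ θ (Nat.cast_ne_zero.mpr hn)] at this

end

/-- for `a = A·B^{d-1}` with `B ≤ A ≤ 2B`, the element `α = a^{1/d}/B`
generates `K = ℚ(a^{1/d})`, has height `A`, and hence `η(K) ≤ √2 · D_K^{1/(2(d-1))}`. -/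
theorem eta_small_family (K : Type*) [Field K] [NumberField K] (d : ℕ) (hd : 1 < d)
    (A B : ℕ) (hA : Squarefree A) (hB : Squarefree B) (hAB : Nat.Coprime A B)
    (hBA : B ≤ A) (hA2B : A ≤ 2 * B) (a : ℕ) (ha : a = A * B ^ (d - 1)) (ha1 : 1 < a)
    (hirr : Irreducible ((Polynomial.X : ℚ[X]) ^ d - Polynomial.C (a : ℚ)))
    (θ : K) (hθ : θ ^ d = (a : K)) (hgen : IntermediateField.adjoin ℚ {θ} = ⊤)
    (hdeg : Module.finrank ℚ K = d) :
    IntermediateField.adjoin ℚ {θ / (B : K)} = ⊤ ∧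
    heightK K (θ / (B : K)) = (A : ℝ) ∧
    etaK K ≤ Real.sqrt 2 * (DK K : ℝ) ^ ((1 : ℝ) / (2 * ((d : ℝ) - 1))) := by
  subst hdeg
  set d := Module.finrank ℚ K
  have hd0 : d ≠ 0 := by lia
  have hB0 : B ≠ 0 := hB.ne_zero
  have hBK : (B : K) ≠ 0 := Nat.cast_ne_zero.mpr hB0
  have hBR : (B : 𝓞 K) ≠ 0 := Nat.cast_ne_zero.mpr hB0
  have hint : IsIntegral ℤ θ := .of_pow (Nat.pos_of_ne_zero hd0) (hθ ▸ isIntegral_natCast a)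
  obtain ⟨t, rfl⟩ : ∃ t : 𝓞 K, (t : K) = θ := ⟨⟨θ, hint⟩, rfl⟩
  have ht : t ^ d = (A : 𝓞 K) * (B : 𝓞 K) ^ (d - 1) := by
    apply RingOfIntegers.ext
    push_cast
    rw [hθ, ha]
    push_cast
    rfl
  have hcop : IsCoprime (A : 𝓞 K) (B : 𝓞 K) := hAB.cast
  obtain ⟨I, J, L, hI, hIJ, hIL, hJL, hJ, hL⟩ :=
    Ideal.exists_factorization_of_pow_eq hd0 hBR hcop ht
  have hden : denIdeal K ((t : K) / (B : K)) = J := by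
    simpa using denIdeal_div_eq hBR hI hIJ hIL hJL
  have hprod : ∏ w : InfinitePlace K, max 1 (w ((t : K) / (B : K))) ^ w.mult
      = (((A : ℚ) / (B : ℚ) : ℚ) : ℝ) := by
    apply prod_max_one_eq_of_pow_finrank_eq
    · rw [one_le_div (by positivity)]
      exact_mod_cast hBA
    · rw [div_pow, hθ, ha, div_eq_iff (pow_ne_zero _ hBK), ← pow_sub_one_mul hd0 (B : K)]
      push_cast
      field_simp
  have hheight : heightK K ((t : K) / (B : K)) = (A : ℝ) := by
    have hBr : (B : ℝ) ≠ 0 := Nat.cast_ne_zero.mpr hB0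
    rw [heightK, hprod, hden, absNorm_eq_of_pow_finrank_eq hJ]
    push_cast
    field_simp
  have hadj := IntermediateField.adjoin_div_natCast_eq_top hgen hB0
  refine ⟨hadj, hheight, (etaK_le_heightK hadj).trans ?_⟩
  rw [hheight]
  have hdvd : (A * B) ^ (d - 1) ∣ DK K := by
    refine pow_finrank_sub_one_dvd_discr (I := L * J)
      ((Nat.squarefree_mul hAB).mpr ⟨hA, hB⟩) ?_
    rw [mul_pow, hL, hJ, Ideal.span_singleton_mul_span_singleton, Nat.cast_mul]
  have hle : ((A * B : ℝ)) ^ (d - 1) ≤ DK K := by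
    exact_mod_cast Nat.le_of_dvd (Int.natAbs_pos.mpr (discr_ne_zero K)) hdvd
  have hsqrt : √(A * B : ℝ) ≤ (DK K : ℝ) ^ ((1 : ℝ) / (2 * ((d : ℝ) - 1))) := by
    have hd1 : (0 : ℝ) < (d : ℝ) - 1 := by
      rw [sub_pos]
      exact_mod_cast hd
    calc √(A * B : ℝ) = ((A * B : ℝ) ^ (d - 1)) ^ ((1 : ℝ) / (2 * ((d : ℝ) - 1))) := by
          rw [Real.sqrt_eq_rpow, ← Real.rpow_natCast, ← Real.rpow_mul (by positivity),
            Nat.cast_sub hd.le, Nat.cast_one]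
          congr 1
          field_simp
      _ ≤ _ := Real.rpow_le_rpow (by positivity) hle (by positivity)
  refine le_trans ?_ (mul_le_mul_of_nonneg_left hsqrt (Real.sqrt_nonneg 2))
  rw [← Real.sqrt_mul zero_le_two]
  apply Real.le_sqrt_of_sq_le
  have : (A : ℝ) ≤ 2 * B := by exact_mod_cast hA2B
  nlinarith [(Nat.cast_nonneg A : (0 : ℝ) ≤ A)]
end
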